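/- Let F be a discretely valued Henselian field with perfect residue field, E/F a finite separable extension inside F^sep, and M/F a finite Galois extension inside F^sep containing a normal closure of E. Then for every r ≥ 0 and all F-algebra embeddings σ, τ : E → F^sep, σ and τ are Ξ^r-equivalent (where Ξ^r := Ξ_{ψ_{E/F}(r)}) if and only if there exists γ in the upper ramification subgroup Gal(M/F)^r with τ = γ ∘ σ; that is, Ξ^r coincides with the relation of lying in the same Gal(M/F)^r-orbit. -/

import Mathlib

noncomputable section

open scoped Classical

/-- An additive `ℝ ∪ {⊤}`-valued valuation on a field `Ω`. -/
structure AddVal (Ω : Type*) [Field Ω] where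
  v : Ω → WithTop ℝ
  v_zero : v 0 = ⊤
  v_ne_top : ∀ x : Ω, x ≠ 0 → v x ≠ ⊤
  v_mul : ∀ x y : Ω, v (x * y) = v x + v y
  v_min_le_add : ∀ x y : Ω, min (v x) (v y) ≤ v (x + y)

namespace AddVal

variable {Ω : Type*} [Field Ω]

/-- `V` is normalized on `F`: its value group on `F^×` is exactly `ℤ`.
This encodes that `F` is a discretely valued field and `V` extends the
normalized discrete valuation `val_F` of `F`. -/
def IsNormalizedOn (V : AddVal Ω) (F : Type*) [Field F] [Algebra F Ω] : Prop :=
  (∀ x : F, x ≠ 0 → ∃ k : ℤ, V.v (algebraMap F Ω x) = ((k : ℝ) : WithTop ℝ)) ∧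
    (∃ x : F, V.v (algebraMap F Ω x) = ((1 : ℝ) : WithTop ℝ))

/-- Henselian property of the valued field `(F, val_F)` (simple-root Hensel lemma). -/
def IsHenselianOn (V : AddVal Ω) (F : Type*) [Field F] [Algebra F Ω] : Prop :=
  ∀ f : Polynomial F,
    (∀ i : ℕ, 0 ≤ V.v (algebraMap F Ω (f.coeff i))) →
      ∀ a₀ : F, 0 ≤ V.v (algebraMap F Ω a₀) →
        0 < V.v (algebraMap F Ω (Polynomial.eval a₀ f)) →
        V.v (algebraMap F Ω (Polynomial.eval a₀ (Polynomial.derivative f))) = 0 →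
        ∃ a : F, Polynomial.eval a f = 0 ∧ 0 < V.v (algebraMap F Ω (a - a₀))

/-- The residue field of `(F, val_F)` is perfect: in positive residue characteristic `p`,
the Frobenius is surjective on the residue field. -/
def HasPerfectResidueFieldOn (V : AddVal Ω) (F : Type*) [Field F] [Algebra F Ω] : Prop :=
  ∀ p : ℕ, p.Prime → 0 < V.v (algebraMap F Ω (p : F)) →
    ∀ x : F, 0 ≤ V.v (algebraMap F Ω x) →
      ∃ y : F, 0 ≤ V.v (algebraMap F Ω y) ∧ 0 < V.v (algebraMap F Ω (x - y ^ p))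

/-- `e` is the (absolute) ramification index of `E` over the field on which `V` is
normalized: the value group of `E^×` is exactly `(1/e)ℤ`.  In particular `E` is
finitely ramified. -/
def IsRamIdx (V : AddVal Ω) {K : Type*} [Field K] [Algebra K Ω]
    (E : IntermediateField K Ω) (e : ℕ) : Prop :=
  0 < e ∧
    (∀ x : ↥E, x ≠ 0 → ∃ k : ℤ, V.v (x : Ω) = ((((k : ℝ) / (e : ℝ) : ℝ)) : WithTop ℝ)) ∧
    (∃ x : ↥E, V.v (x : Ω) = (((1 / (e : ℝ) : ℝ)) : WithTop ℝ))

end AddVal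

/-- The lower ramification relation `Ξ_r` on `K`-algebra embeddings of `E` into `Ω`,
where `e` is the absolute ramification index of `E` (over the normalization field of `V`):
`σ Ξ_r τ` iff `val_M (σ x - τ x) ≥ e(M/E) (r+1)` for all integral `x` and any (equivalently
some) suitable Galois `M`; this is equivalent to `V.v (σ x - τ x) ≥ (r+1)/e` for all
integral `x`. -/
def xiRel {Ω : Type*} [Field Ω] (V : AddVal Ω) {K : Type*} [Field K] [Algebra K Ω]
    (E : IntermediateField K Ω) (e : ℕ) (r : ℝ) (σ τ : ↥E →ₐ[K] Ω) : Prop :=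
  ∀ x : ↥E, 0 ≤ V.v (x : Ω) →
    ((((r + 1) / (e : ℝ) : ℝ)) : WithTop ℝ) ≤ V.v (σ x - τ x)

/-- `g_t`: the (common) cardinality of a `Ξ_t`-equivalence class, realized as the
cardinality of the class of the inclusion `E ↪ Ω`. -/
def gfun {Ω : Type*} [Field Ω] (V : AddVal Ω) {K : Type*} [Field K] [Algebra K Ω]
    (E : IntermediateField K Ω) (e : ℕ) (t : ℝ) : ℕ :=
  Nat.card {σ : ↥E →ₐ[K] Ω // xiRel V E e t σ E.val}

/-- The Herbrand function `φ_{E/K}(r) = ∫_0^r (g_t / g_0) dt`. -/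
def herbrand {Ω : Type*} [Field Ω] (V : AddVal Ω) {K : Type*} [Field K] [Algebra K Ω]
    (E : IntermediateField K Ω) (e : ℕ) (r : ℝ) : ℝ :=
  ∫ t in (0:ℝ)..r, ((gfun V E e t : ℝ) / (gfun V E e 0 : ℝ))

/-- `E/K` is at most `l`-ramified: for every finite subextension `E₀/K` the relation
`Ξ^l = Ξ_{ψ_{E₀/K}(l)}` is trivial. -/
def atMostRamified {Ω : Type*} [Field Ω] (V : AddVal Ω) {K : Type*} [Field K] [Algebra K Ω]
    (E : IntermediateField K Ω) (l : ℝ) : Prop :=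
  ∀ E₀ : IntermediateField K Ω, E₀ ≤ E → FiniteDimensional K ↥E₀ →
    ∀ (e₀ : ℕ) (s : ℝ), V.IsRamIdx E₀ e₀ → 0 ≤ s → herbrand V E₀ e₀ s = l →
      ∀ σ τ : ↥E₀ →ₐ[K] Ω, xiRel V E₀ e₀ s σ τ → σ = τ

/-- Membership of `γ ∈ Γ_K` in the upper ramification subgroup `I_K^l`: for every
finite Galois subextension `M/K` (with ramification index `eM` and `ψ_{M/K}(l) = sM`),
the image of `γ` in `Gal(M/K)` lies in `Gal(M/K)^l = Gal(M/K)_{ψ_{M/K}(l)}`. -/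
def inUpperRam {Ω : Type*} [Field Ω] (V : AddVal Ω) {K : Type*} [Field K] [Algebra K Ω]
    (l : ℝ) (γ : Ω ≃ₐ[K] Ω) : Prop :=
  ∀ (M : IntermediateField K Ω) (eM : ℕ) (sM : ℝ),
    FiniteDimensional K ↥M → IsGalois K ↥M → V.IsRamIdx M eM → 0 ≤ sM →
      herbrand V M eM sM = l →
      xiRel V M eM sM (γ.toAlgHom.comp M.val) M.val

/-- Truncation of an extended real number at a real level. -/
def truncAt (a : WithTop ℝ) (c : ℝ) : ℝ := (min a (c : WithTop ℝ)).untopD 0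

lemma coe_truncAt (a : WithTop ℝ) (c : ℝ) : (truncAt a c : WithTop ℝ) = min a c := by
  induction a with
  | top => simp [truncAt]
  | coe a => rw [truncAt, ← WithTop.coe_min, WithTop.untopD_coe]

lemma truncAt_coe (a c : ℝ) : truncAt (a : WithTop ℝ) c = min a c := by
  have := coe_truncAt (a : WithTop ℝ) c
  rw [← WithTop.coe_min] at this
  exact_mod_cast this

lemma truncAt_top (c : ℝ) : truncAt ⊤ c = c := by simp [truncAt]

lemma truncAt_of_le {a : WithTop ℝ} {c : ℝ} (h : (c : WithTop ℝ) ≤ a) : truncAt a c = c := by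
  have := coe_truncAt a c
  rw [min_eq_right h] at this
  exact_mod_cast this

lemma coe_truncAt_of_le {a : WithTop ℝ} {c : ℝ} (h : a ≤ (c : WithTop ℝ)) :
    (truncAt a c : WithTop ℝ) = a := by
  rw [coe_truncAt, min_eq_left h]

lemma truncAt_mono (a : WithTop ℝ) {c d : ℝ} (h : c ≤ d) : truncAt a c ≤ truncAt a d := by
  rw [← WithTop.coe_le_coe, coe_truncAt, coe_truncAt]
  exact min_le_min_left _ (by exact_mod_cast h)

lemma coe_sum_withTop {ι : Type*} (s : Finset ι) (f : ι → ℝ) :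
    ((∑ x ∈ s, f x : ℝ) : WithTop ℝ) = ∑ x ∈ s, (f x : WithTop ℝ) :=
  WithTop.coe_sum s f

/-- The Lebesgue measure of `{t ∈ [0, s] | (t + 1) / e ≤ a}`. -/
def ramp (e : ℝ) (a : WithTop ℝ) (s : ℝ) : ℝ := max (e * truncAt a ((s + 1) / e) - 1) 0

lemma ramp_top {e s : ℝ} (he : 0 < e) (hs : 0 ≤ s) : ramp e ⊤ s = s := by
  rw [ramp, truncAt_top, mul_div_cancel₀ _ he.ne']
  simpa using hs

lemma ramp_mono {e s t : ℝ} (he : 0 < e) (a : WithTop ℝ) (h : s ≤ t) :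
    ramp e a s ≤ ramp e a t := by
  unfold ramp
  have := truncAt_mono a (show (s + 1) / e ≤ (t + 1) / e by gcongr)
  gcongr

lemma integral_indicator_eq_ramp {e s : ℝ} (he : 0 < e) (hs : 0 ≤ s) (a : WithTop ℝ) :
    IntervalIntegrable
      (fun t : ℝ => if (((t + 1) / e : ℝ) : WithTop ℝ) ≤ a then (1 : ℝ) else 0)
      MeasureTheory.volume 0 s ∧
    ∫ t in (0 : ℝ)..s, (if (((t + 1) / e : ℝ) : WithTop ℝ) ≤ a then (1 : ℝ) else 0) =
      ramp e a s := by
  induction a with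
  | top => simp [ramp_top he hs]
  | coe a =>
    have hcond : ∀ t : ℝ, (((t + 1) / e : ℝ) : WithTop ℝ) ≤ (a : WithTop ℝ) ↔ t ≤ e * a - 1 := by
      intro t
      rw [WithTop.coe_le_coe, div_le_iff₀ he, mul_comm a e, le_sub_iff_add_le]
    simp only [hcond]
    have hfun : (fun t : ℝ => if t ≤ e * a - 1 then (1 : ℝ) else 0) =
        (Set.Iic (e * a - 1)).indicator (fun _ => 1) := by
      ext t; simp [Set.indicator_apply]
    refine ⟨?_, ?_⟩
    · rw [hfun, intervalIntegrable_iff, Set.uIoc_of_le hs]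
      exact (MeasureTheory.integrable_const (1 : ℝ)).indicator measurableSet_Iic
    · rw [hfun, intervalIntegral.integral_of_le hs,
        MeasureTheory.setIntegral_indicator measurableSet_Iic, Set.Ioc_inter_Iic]
      simp only [MeasureTheory.integral_const, smul_eq_mul, mul_one, MeasureTheory.measureReal_def,
        MeasurableSet.univ, MeasureTheory.Measure.restrict_apply, Set.univ_inter, Real.volume_Ioc,
        sub_zero]
      rw [ENNReal.toReal_ofReal', ramp, truncAt_coe, mul_min_of_nonneg _ _ he.le,
        mul_div_cancel₀ _ he.ne']
      rw [min_comm, ← min_sub_sub_right]; simp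

section Abstract

variable {G : Type*} [Group G] (H : Subgroup G) (i : G → WithTop ℝ)

lemma min_eq_of_le_left (i_mul : ∀ a b, min (i a) (i b) ≤ i (a * b)) (i_inv : ∀ a, i a⁻¹ = i a)
    {c : WithTop ℝ} {a : G} (ha : c ≤ i a) (b : G) : min (i (a * b)) c = min (i b) c := by
  apply le_antisymm
  · refine le_min ?_ (min_le_right _ _)
    have := i_mul a⁻¹ (a * b)
    rw [inv_mul_cancel_left, i_inv] at this
    refine le_trans (le_min ((min_le_right _ _).trans ha) (min_le_left _ _)) this
  · refine le_min ?_ (min_le_right _ _)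
    exact le_trans (le_min ((min_le_right _ _).trans ha) (min_le_left _ _)) (i_mul a b)

lemma truncAt_eq_of_le_left (i_mul : ∀ a b, min (i a) (i b) ≤ i (a * b))
    (i_inv : ∀ a, i a⁻¹ = i a) {c : ℝ} {a : G} (ha : (c : WithTop ℝ) ≤ i a) (b : G) :
    truncAt (i (a * b)) c = truncAt (i b) c := by
  unfold truncAt
  rw [min_eq_of_le_left i i_mul i_inv ha]

lemma le_iff_of_le_left (i_mul : ∀ a b, min (i a) (i b) ≤ i (a * b))
    (i_inv : ∀ a, i a⁻¹ = i a) {c : ℝ} {a : G} (ha : (c : WithTop ℝ) ≤ i a) (b : G) :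
    (c : WithTop ℝ) ≤ i (a * b) ↔ (c : WithTop ℝ) ≤ i b := by
  rw [← min_eq_right_iff, min_eq_of_le_left i i_mul i_inv ha, min_eq_right_iff]

variable [Fintype G]

/-- The sum of `i` over the left coset of `γ`. -/
def cosetSum (γ : G) : WithTop ℝ := ∑ h : H, i (γ * h)

/-- The sum over `H` of the truncations of `i`. -/
def truncSum (c : ℝ) : ℝ := ∑ h : H, truncAt (i h) c

lemma sum_coset_shift {R : Type*} [AddCommMonoid R] (f : G → R) (γ : G) (h₀ : H) :
    ∑ h : H, f (γ * h) = ∑ h : H, f (γ * h₀ * h) := by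
  rw [← Equiv.sum_comp (Equiv.mulLeft h₀)]
  simp [mul_assoc]

variable (i_one : i 1 = ⊤) (i_mul : ∀ a b, min (i a) (i b) ≤ i (a * b))
  (i_inv : ∀ a, i a⁻¹ = i a)
include i_mul i_inv

lemma sum_truncAt_coset {γ : G} {c : ℝ} (h : ∃ h : H, (c : WithTop ℝ) ≤ i (γ * h)) :
    ∑ h : H, truncAt (i (γ * h)) c = truncSum H i c := by
  obtain ⟨h₀, hh₀⟩ := h
  rw [sum_coset_shift H (fun g => truncAt (i g) c) γ h₀]
  exact Finset.sum_congr rfl fun h _ => truncAt_eq_of_le_left i i_mul i_inv hh₀ _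

lemma truncSum_le_cosetSum {γ : G} {c : ℝ} (h : ∃ h : H, (c : WithTop ℝ) ≤ i (γ * h)) :
    (truncSum H i c : WithTop ℝ) ≤ cosetSum H i γ := by
  rw [← sum_truncAt_coset H i i_mul i_inv h, coe_sum_withTop, cosetSum]
  exact Finset.sum_le_sum fun h _ => (coe_truncAt _ _).trans_le (min_le_left _ _)

include i_one in
lemma cosetSum_lt_truncSum {γ : G} {c : ℝ} (h : ∀ h : H, i (γ * h) < (c : WithTop ℝ)) :
    cosetSum H i γ = ((∑ h : H, truncAt (i (γ * h)) c : ℝ) : WithTop ℝ) ∧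
      ∑ h : H, truncAt (i (γ * h)) c < truncSum H i c := by
  have h1 : cosetSum H i γ = ((∑ h : H, truncAt (i (γ * h)) c : ℝ) : WithTop ℝ) := by
    rw [coe_sum_withTop, cosetSum]
    exact Finset.sum_congr rfl fun x _ => (coe_truncAt_of_le (h x).le).symm
  refine ⟨h1, ?_⟩
  obtain ⟨h₀, -, hmax⟩ := Finset.exists_max_image Finset.univ (fun x : H => i (γ * x))
    Finset.univ_nonempty
  rw [sum_coset_shift H (fun g => truncAt (i g) c) γ h₀, truncSum]
  have key : ∀ x : H, i (γ * h₀ * x) ≤ i x := by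
    intro x
    have h2 := i_mul (γ * h₀)⁻¹ (γ * h₀ * x)
    rw [inv_mul_cancel_left, i_inv] at h2
    refine le_trans (le_min ?_ le_rfl) h2
    have := hmax (h₀ * x) (Finset.mem_univ _)
    simpa [mul_assoc] using this
  apply Finset.sum_lt_sum
  · intro x _
    rw [← WithTop.coe_le_coe, coe_truncAt, coe_truncAt]
    exact min_le_min_right _ (key x)
  · refine ⟨1, Finset.mem_univ _, ?_⟩
    rw [← WithTop.coe_lt_coe, coe_truncAt, coe_truncAt]
    simp only [OneMemClass.coe_one, mul_one, i_one, le_top, inf_of_le_right]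
    exact lt_of_le_of_lt (min_le_left _ _) (h h₀)

include i_one in
lemma truncSum_le_cosetSum_iff {γ : G} {c : ℝ} :
    (truncSum H i c : WithTop ℝ) ≤ cosetSum H i γ ↔ ∃ h : H, (c : WithTop ℝ) ≤ i (γ * h) := by
  refine ⟨fun h => ?_, truncSum_le_cosetSum H i i_mul i_inv⟩
  by_contra! hcon
  obtain ⟨h1, h2⟩ := cosetSum_lt_truncSum H i i_one i_mul i_inv hcon
  rw [h1, WithTop.coe_le_coe] at h
  exact absurd h2 (not_lt.mpr h)

include i_one in
lemma truncAt_cosetSum (γ : G) (c : ℝ) :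
    truncAt (cosetSum H i γ) (truncSum H i c) = ∑ h : H, truncAt (i (γ * h)) c := by
  by_cases hex : ∃ h : H, (c : WithTop ℝ) ≤ i (γ * h)
  · rw [truncAt_of_le (truncSum_le_cosetSum H i i_mul i_inv hex),
      sum_truncAt_coset H i i_mul i_inv hex]
  · push Not at hex
    obtain ⟨h1, h2⟩ := cosetSum_lt_truncSum H i i_one i_mul i_inv hex
    rw [h1, truncAt_coe, min_eq_left h2.le]

omit i_mul i_inv [Group G] [Fintype G] in
lemma ramp_eq_of_jump {eM u : ℝ} (heM : 0 < eM) (hu : 0 ≤ u) {a : WithTop ℝ}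
    (ha : a < ((1 / eM : ℝ) : WithTop ℝ) → a = 0) :
    ramp eM a u = eM * truncAt a ((u + 1) / eM) -
      if ((1 / eM : ℝ) : WithTop ℝ) ≤ a then 1 else 0 := by
  unfold ramp
  split_ifs with h
  · apply max_eq_left
    rw [sub_nonneg]
    have h1 : 1 / eM ≤ truncAt a ((u + 1) / eM) := by
      rw [← WithTop.coe_le_coe, coe_truncAt]
      refine le_min h ?_
      rw [WithTop.coe_le_coe]
      gcongr
      linarith
    rw [div_le_iff₀ heM] at h1
    linarith
  · have h0 := ha (not_le.mp h)
    subst h0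
    have : truncAt 0 ((u + 1) / eM) = 0 := by
      have := truncAt_coe 0 ((u + 1) / eM)
      rw [WithTop.coe_zero] at this
      rw [this]
      exact min_eq_left (by positivity)
    simp [this]

variable {eE eM : ℝ} (heE : 0 < eE) (heM : 0 < eM)
  (i_small : ∀ γ, i γ < ((1 / eM : ℝ) : WithTop ℝ) → i γ = 0)
  (hcard : (∑ h : H, if ((1 / eM : ℝ) : WithTop ℝ) ≤ i h then (1 : ℝ) else 0) * eE = eM)

omit [Group G] [Fintype G] i_mul i_inv in
lemma card_pos_of_mul_eq {N : ℝ} (heE : 0 < eE) (heM : 0 < eM) (h : N * eE = eM) : 0 < N := by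
  by_contra! hN
  nlinarith

lemma sum_indicator_coset {γ : G} {c : ℝ} (h : ∃ h : H, (c : WithTop ℝ) ≤ i (γ * h)) :
    (∑ h : H, if (c : WithTop ℝ) ≤ i (γ * h) then (1 : ℝ) else 0) =
      ∑ h : H, if (c : WithTop ℝ) ≤ i h then (1 : ℝ) else 0 := by
  obtain ⟨h₀, hh₀⟩ := h
  rw [sum_coset_shift H (fun g => if (c : WithTop ℝ) ≤ i g then (1 : ℝ) else 0) γ h₀]
  exact Finset.sum_congr rfl fun h _ => by simp only [le_iff_of_le_left i i_mul i_inv hh₀]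

include heE heM i_small hcard

omit i_mul i_inv in
lemma truncSum_one_div : truncSum H i (1 / eM) = 1 / eE := by
  have h1 : ∀ h : H, truncAt (i h) (1 / eM) =
      (if ((1 / eM : ℝ) : WithTop ℝ) ≤ i h then (1 : ℝ) else 0) * (1 / eM) := by
    intro h
    split_ifs with hh
    · rw [truncAt_of_le hh, one_mul]
    · rw [i_small _ (not_le.mp hh), ← WithTop.coe_zero, truncAt_coe, zero_mul]
      exact min_eq_left (by positivity)
  rw [truncSum, Finset.sum_congr rfl fun h _ => h1 h, ← Finset.sum_mul]
  have hN := card_pos_of_mul_eq heE heM hcard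
  field_simp
  linarith

include i_one

lemma indicator_cosetSum (γ : G) :
    (if ((1 / eE : ℝ) : WithTop ℝ) ≤ cosetSum H i γ then (1 : ℝ) else 0) *
      (∑ h : H, if ((1 / eM : ℝ) : WithTop ℝ) ≤ i h then (1 : ℝ) else 0) =
      ∑ h : H, if ((1 / eM : ℝ) : WithTop ℝ) ≤ i (γ * h) then (1 : ℝ) else 0 := by
  rw [← truncSum_one_div H i heE heM i_small hcard]
  simp only [truncSum_le_cosetSum_iff H i i_one i_mul i_inv]
  split_ifs with h
  · rw [one_mul, sum_indicator_coset H i i_mul i_inv h]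
  · push Not at h
    rw [zero_mul, eq_comm]
    exact Finset.sum_eq_zero fun x _ => if_neg (not_le.mpr (h x))

lemma ramp_cosetSum {u : ℝ} (hu : 0 ≤ u) (γ : G) :
    ramp eE (cosetSum H i γ) (eE * truncSum H i ((u + 1) / eM) - 1) *
      (∑ h : H, if ((1 / eM : ℝ) : WithTop ℝ) ≤ i h then (1 : ℝ) else 0) =
      ∑ h : H, ramp eM (i (γ * h)) u := by
  set N := ∑ h : H, if ((1 / eM : ℝ) : WithTop ℝ) ≤ i h then (1 : ℝ) else 0
  have hN := card_pos_of_mul_eq heE heM hcard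
  have hrhs : ∑ h : H, ramp eM (i (γ * h)) u =
      eM * ∑ h : H, truncAt (i (γ * h)) ((u + 1) / eM) -
        ∑ h : H, if ((1 / eM : ℝ) : WithTop ℝ) ≤ i (γ * h) then (1 : ℝ) else 0 := by
    rw [Finset.mul_sum, ← Finset.sum_sub_distrib]
    exact Finset.sum_congr rfl fun h _ => ramp_eq_of_jump heM hu (i_small _)
  have hnn : 0 ≤ ∑ h : H, ramp eM (i (γ * h)) u :=
    Finset.sum_nonneg fun h _ => le_max_right _ _
  rw [ramp, sub_add_cancel, mul_div_cancel_left₀ _ heE.ne',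
    truncAt_cosetSum H i i_one i_mul i_inv]
  by_cases hex : ∃ h : H, ((1 / eM : ℝ) : WithTop ℝ) ≤ i (γ * h)
  · rw [hrhs, sum_indicator_coset H i i_mul i_inv hex] at hnn ⊢
    set T := ∑ h : H, truncAt (i (γ * h)) ((u + 1) / eM)
    have hT : eM * T - N = N * (eE * T - 1) := by rw [← hcard]; ring
    rw [hT] at hnn ⊢
    rw [max_eq_left (by nlinarith), mul_comm]
  · push Not at hex
    have h0 : ∀ h : H, i (γ * h) = 0 := fun h => i_small _ (hex h)
    have ht : truncAt 0 ((u + 1) / eM) = 0 := by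
      rw [← WithTop.coe_zero, truncAt_coe]
      exact min_eq_left (by positivity)
    simp [h0, ht, ramp]

/-- Abstract form of Herbrand's theorem for the passage from `G` to the cosets of `H`. -/
theorem le_cosetSum_iff_of_herbrand_eq {P : Type*} [Fintype P] (lift : P → G)
    (hlift : Function.Bijective fun x : P × H => lift x.1 * x.2)
    {s u : ℝ} (hs : 0 ≤ s) (hu : 0 ≤ u)
    (heq : (∑ p, ramp eE (cosetSum H i (lift p)) s) /
        (∑ p, if ((1 / eE : ℝ) : WithTop ℝ) ≤ cosetSum H i (lift p) then (1 : ℝ) else 0) =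
      (∑ g, ramp eM (i g) u) / (∑ g, if ((1 / eM : ℝ) : WithTop ℝ) ≤ i g then (1 : ℝ) else 0))
    (γ : G) :
    (((s + 1) / eE : ℝ) : WithTop ℝ) ≤ cosetSum H i γ ↔
      ∃ h : H, (((u + 1) / eM : ℝ) : WithTop ℝ) ≤ i (γ * h) := by
  set N := ∑ h : H, if ((1 / eM : ℝ) : WithTop ℝ) ≤ i h then (1 : ℝ) else 0 with hNdef
  have hN : 0 < N := card_pos_of_mul_eq heE heM hcard
  have hsum : ∀ f : G → ℝ, ∑ g, f g = ∑ p, ∑ h : H, f (lift p * h) := by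
    intro f
    rw [← Fintype.sum_prod_type' (f := fun p (h : H) => f (lift p * h))]
    exact (Equiv.sum_comp (Equiv.ofBijective _ hlift) f).symm
  set ψ := eE * truncSum H i ((u + 1) / eM) - 1 with hψ
  have h1 : ∑ g, ramp eM (i g) u = (∑ p, ramp eE (cosetSum H i (lift p)) ψ) * N := by
    rw [hsum, Finset.sum_mul]
    exact Finset.sum_congr rfl fun p _ =>
      (ramp_cosetSum H i i_one i_mul i_inv heE heM i_small hcard hu _).symm
  have h2 : (∑ g, if ((1 / eM : ℝ) : WithTop ℝ) ≤ i g then (1 : ℝ) else 0) =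
      (∑ p, if ((1 / eE : ℝ) : WithTop ℝ) ≤ cosetSum H i (lift p) then (1 : ℝ) else 0) * N := by
    rw [hsum, Finset.sum_mul]
    exact Finset.sum_congr rfl fun p _ =>
      (indicator_cosetSum H i i_one i_mul i_inv heE heM i_small hcard _).symm
  obtain ⟨⟨p₀, h₀⟩, hp₀⟩ := hlift.2 1
  have hp₀' : cosetSum H i (lift p₀) = ⊤ := by
    rw [cosetSum, WithTop.sum_eq_top]
    exact ⟨h₀, Finset.mem_univ _, by rw [← i_one]; exact congrArg i hp₀⟩
  have hpos : 0 < ∑ p, if ((1 / eE : ℝ) : WithTop ℝ) ≤ cosetSum H i (lift p)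
      then (1 : ℝ) else 0 := by
    refine Finset.sum_pos' (fun p _ => by split_ifs <;> norm_num) ⟨p₀, Finset.mem_univ _, ?_⟩
    simp [hp₀']
  rw [h1, h2, mul_div_mul_right _ _ hN.ne', div_left_inj' hpos.ne'] at heq
  have hψ0 : 0 ≤ ψ := by
    rw [hψ, sub_nonneg]
    have : truncSum H i (1 / eM) ≤ truncSum H i ((u + 1) / eM) :=
      Finset.sum_le_sum fun h _ => truncAt_mono _ (by gcongr; linarith)
    rw [truncSum_one_div H i heE heM i_small hcard, div_le_iff₀ heE] at this
    linarith
  have hmono : ∀ a b : ℝ, 0 ≤ a → a < b → ∑ p, ramp eE (cosetSum H i (lift p)) a <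
      ∑ p, ramp eE (cosetSum H i (lift p)) b := by
    intro a b ha hab
    refine Finset.sum_lt_sum (fun p _ => ramp_mono heE _ hab.le) ⟨p₀, Finset.mem_univ _, ?_⟩
    rwa [hp₀', ramp_top heE ha, ramp_top heE (ha.trans hab.le)]
  have hsψ : s = ψ := by
    rcases lt_trichotomy s ψ with h | h | h
    · exact absurd heq (hmono _ _ hs h).ne
    · exact h
    · exact absurd heq (hmono _ _ hψ0 h).ne'
  rw [hsψ, hψ, sub_add_cancel, mul_div_cancel_left₀ _ heE.ne',
    truncSum_le_cosetSum_iff H i i_one i_mul i_inv]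

end Abstract

namespace AddVal

variable {K L : Type*} [Field K] [Field L] (V : AddVal L)

lemma v_one : V.v 1 = 0 := by
  have h := V.v_mul 1 1
  rw [mul_one] at h
  have h1 := V.v_ne_top 1 one_ne_zero
  lift V.v 1 to ℝ using h1 with a
  norm_cast at h ⊢
  linarith

lemma v_pow (x : L) (n : ℕ) : V.v (x ^ n) = n • V.v x := by
  induction n with
  | zero => simp [v_one]
  | succ n ih => rw [pow_succ, V.v_mul, ih, succ_nsmul]

lemma v_eq_top {x : L} : V.v x = ⊤ ↔ x = 0 :=
  ⟨fun h => by by_contra hx; exact V.v_ne_top x hx h, fun h => h ▸ V.v_zero⟩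

lemma v_neg_one : V.v (-1) = 0 := by
  have h := V.v_mul (-1) (-1)
  rw [neg_mul_neg, mul_one, v_one] at h
  have h1 := V.v_ne_top (-1) (by simp)
  lift V.v (-1) to ℝ using h1 with a
  norm_cast at h ⊢
  linarith

@[simp] lemma v_neg (x : L) : V.v (-x) = V.v x := by
  rw [← neg_one_mul, V.v_mul, v_neg_one, zero_add]

lemma v_sub_comm (x y : L) : V.v (x - y) = V.v (y - x) := by
  rw [← V.v_neg, neg_sub]

lemma min_le_v_sub (x y : L) : min (V.v x) (V.v y) ≤ V.v (x - y) := by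
  rw [sub_eq_add_neg, ← V.v_neg y]
  exact V.v_min_le_add x (-y)

lemma le_v_add {c : WithTop ℝ} {x y : L} (hx : c ≤ V.v x) (hy : c ≤ V.v y) : c ≤ V.v (x + y) :=
  (le_min hx hy).trans (V.v_min_le_add x y)

lemma le_v_sub {c : WithTop ℝ} {x y : L} (hx : c ≤ V.v x) (hy : c ≤ V.v y) : c ≤ V.v (x - y) :=
  (le_min hx hy).trans (V.min_le_v_sub x y)

lemma lt_v_add {c : WithTop ℝ} {x y : L} (hx : c < V.v x) (hy : c < V.v y) : c < V.v (x + y) :=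
  (lt_min hx hy).trans_le (V.v_min_le_add x y)

lemma lt_v_sub {c : WithTop ℝ} {x y : L} (hx : c < V.v x) (hy : c < V.v y) : c < V.v (x - y) :=
  (lt_min hx hy).trans_le (V.min_le_v_sub x y)

lemma le_v_sum {ι : Type*} (s : Finset ι) (f : ι → L) {c : WithTop ℝ}
    (h : ∀ j ∈ s, c ≤ V.v (f j)) : c ≤ V.v (∑ j ∈ s, f j) := by
  induction s using Finset.induction_on with
  | empty => simp [V.v_zero]
  | insert a s ha ih =>
    rw [Finset.sum_insert ha]
    exact V.le_v_add (h a (by simp)) (ih fun j hj => h j (by simp [hj]))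

lemma v_prod {ι : Type*} (s : Finset ι) (f : ι → L) :
    V.v (∏ j ∈ s, f j) = ∑ j ∈ s, V.v (f j) := by
  induction s using Finset.induction_on with
  | empty => simp [V.v_one]
  | insert a s ha ih => rw [Finset.prod_insert ha, Finset.sum_insert ha, V.v_mul, ih]

lemma v_add_eq_of_lt {x y : L} (h : V.v x < V.v y) : V.v (x + y) = V.v x := by
  refine le_antisymm ?_ ((le_min le_rfl h.le).trans (V.v_min_le_add x y))
  by_contra! hc
  have : V.v x < V.v (x + y - y) := V.lt_v_sub hc h
  simp at this

lemma v_eq_zero_of_sub {x y : L} (hy : V.v y = 0) (h : 0 < V.v (x - y)) : V.v x = 0 := by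
  have := V.v_add_eq_of_lt (x := y) (y := x - y) (hy ▸ h)
  rwa [add_sub_cancel, hy] at this

lemma v_inv_add (x : L) (hx : x ≠ 0) : V.v x⁻¹ + V.v x = 0 := by
  rw [← V.v_mul, inv_mul_cancel₀ hx, V.v_one]

lemma v_inv_nonneg {x : L} (hx : V.v x = 0) : V.v x⁻¹ = 0 := by
  have h0 : x ≠ 0 := by rintro rfl; simp [V.v_zero] at hx
  simpa [hx] using V.v_inv_add x h0

/-- The restriction of an additive valuation along a field homomorphism. -/
def comap (f : K →+* L) : AddVal K where
  v x := V.v (f x)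
  v_zero := by simp [V.v_zero]
  v_ne_top x hx := V.v_ne_top _ (by simpa using hx)
  v_mul x y := by simp [V.v_mul]
  v_min_le_add x y := by simpa using V.v_min_le_add (f x) (f y)

@[simp] lemma comap_v (f : K →+* L) (x : K) : (V.comap f).v x = V.v (f x) := rfl

/-- The valuation ring of an additive valuation. -/
def integers : ValuationSubring L where
  carrier := {x | 0 ≤ V.v x}
  mul_mem' {x y} hx hy := by
    simp only [Set.mem_ofPred_eq] at *
    rw [V.v_mul]; exact add_nonneg hx hy
  one_mem' := by simp [V.v_one]
  add_mem' hx hy := V.le_v_add hx hy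
  zero_mem' := by simp [V.v_zero]
  neg_mem' {x} hx := by simpa using hx
  mem_or_inv_mem' x := by
    by_cases hx : x = 0
    · left; simp [hx, V.v_zero]
    · have h := V.v_inv_add x hx
      have h1 := V.v_ne_top x hx
      have h2 := V.v_ne_top x⁻¹ (inv_ne_zero hx)
      simp only [Set.mem_ofPred_eq]
      lift V.v x to ℝ using h1 with a
      lift V.v x⁻¹ to ℝ using h2 with b
      norm_cast at h ⊢
      rcases le_total 0 a with h | h
      · left; exact h
      · right; linarith

lemma mem_integers {x : L} : x ∈ V.integers ↔ 0 ≤ V.v x := Iff.rfl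

lemma isUnit_integers_iff (x : V.integers) : IsUnit x ↔ V.v (x : L) = 0 := by
  constructor
  · rintro ⟨u, rfl⟩
    have h : V.v ((u : V.integers) : L) + V.v ((u⁻¹ : V.integersˣ) : V.integers) = 0 := by
      rw [← V.v_mul, ← V.v_one]
      congr 1
      exact_mod_cast congrArg Subtype.val (u.mul_inv)
    exact (add_eq_zero_iff_of_nonneg u.1.2 (u⁻¹).1.2).1 h |>.1
  · intro h
    have h0 : (x : L) ≠ 0 := by intro h0; simp [h0, V.v_zero] at h
    refine IsUnit.of_mul_eq_one ⟨(x : L)⁻¹, (V.v_inv_nonneg h).ge⟩ ?_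
    ext; simp [h0]

lemma mem_maximalIdeal_iff (x : V.integers) :
    x ∈ IsLocalRing.maximalIdeal V.integers ↔ 0 < V.v (x : L) := by
  rw [IsLocalRing.mem_maximalIdeal, mem_nonunits_iff, isUnit_integers_iff, lt_iff_le_and_ne]
  exact ⟨fun h => ⟨x.2, Ne.symm h⟩, fun h => h.2.symm⟩

/-- The value group of `V` is `(1/e)ℤ`. -/
def HasIndex (e : ℕ) : Prop :=
  0 < e ∧ (∀ x, x ≠ 0 → ∃ k : ℤ, V.v x = (((k : ℝ) / (e : ℝ) : ℝ) : WithTop ℝ)) ∧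
    ∃ x, V.v x = ((1 / (e : ℝ) : ℝ) : WithTop ℝ)

variable {V}

lemma HasIndex.nat_div {e : ℕ} (h : V.HasIndex e) {x : L} (hx : 0 ≤ V.v x) (h0 : x ≠ 0) :
    ∃ k : ℕ, V.v x = (((k : ℝ) / (e : ℝ) : ℝ) : WithTop ℝ) := by
  obtain ⟨k, hk⟩ := h.2.1 x h0
  have he : (0 : ℝ) < e := by exact_mod_cast h.1
  rw [hk] at hx
  have : (0 : ℝ) ≤ (k : ℝ) / e := by exact_mod_cast hx
  have hk0 : 0 ≤ k := by
    by_contra! hc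
    have : (k : ℝ) / e < 0 := div_neg_of_neg_of_pos (by exact_mod_cast hc) he
    linarith
  lift k to ℕ using hk0
  exact ⟨k, by simpa using hk⟩

lemma HasIndex.eq_zero_of_lt {e : ℕ} (h : V.HasIndex e) {x : L} (hx : 0 ≤ V.v x)
    (hlt : V.v x < ((1 / (e : ℝ) : ℝ) : WithTop ℝ)) : V.v x = 0 := by
  by_cases h0 : x = 0
  · simp [h0, V.v_zero] at hlt
  obtain ⟨k, hk⟩ := h.nat_div hx h0
  have he : (0 : ℝ) < e := by exact_mod_cast h.1
  rw [hk] at hlt ⊢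
  have h1 : (k : ℝ) / e < 1 / e := by exact_mod_cast hlt
  rw [div_lt_div_iff_of_pos_right he] at h1
  have : k = 0 := by
    have : k < 1 := by exact_mod_cast h1
    omega
  simp [this]

lemma HasIndex.le_of_pos {e : ℕ} (h : V.HasIndex e) {x : L} (hx : 0 < V.v x) :
    ((1 / (e : ℝ) : ℝ) : WithTop ℝ) ≤ V.v x := by
  by_contra! hc
  exact hx.ne' (h.eq_zero_of_lt hx.le hc)

lemma HasIndex.one_div_pos {e : ℕ} (h : V.HasIndex e) : (0 : ℝ) < 1 / (e : ℝ) := by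
  have he : (0 : ℝ) < e := by exact_mod_cast h.1
  positivity

lemma v_pow_uniformizer {e : ℕ} {x : L} (h : V.v x = ((1 / (e : ℝ) : ℝ) : WithTop ℝ)) (n : ℕ) :
    V.v (x ^ n) = (((n : ℝ) / (e : ℝ) : ℝ) : WithTop ℝ) := by
  rw [V.v_pow, h, ← WithTop.coe_nsmul, nsmul_eq_mul, mul_one_div]

lemma HasIndex.uniformizer_spec {e : ℕ} (h : V.HasIndex e) {ϖ : V.integers}
    (hϖ : V.v (ϖ : L) = ((1 / (e : ℝ) : ℝ) : WithTop ℝ)) (x : V.integers) (hx : x ≠ 0) :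
    ∃ (n : ℕ) (u : V.integersˣ), V.v (x : L) = (((n : ℝ) / (e : ℝ) : ℝ) : WithTop ℝ) ∧
      x = ϖ ^ n * u := by
  have hx' : (x : L) ≠ 0 := by simpa using hx
  obtain ⟨n, hn⟩ := h.nat_div x.2 hx'
  have hϖ0 : (ϖ : L) ≠ 0 := by intro h0; simp [h0, V.v_zero] at hϖ
  have hq : V.v ((x : L) / (ϖ : L) ^ n) = 0 := by
    have h1 : V.v ((x : L) / (ϖ : L) ^ n) + V.v ((ϖ : L) ^ n) = V.v (x : L) := by
      rw [← V.v_mul, div_mul_cancel₀ _ (pow_ne_zero _ hϖ0)]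
    rw [v_pow_uniformizer hϖ, hn] at h1
    have h2 := V.v_ne_top ((x : L) / (ϖ : L) ^ n) (div_ne_zero hx' (pow_ne_zero _ hϖ0))
    lift V.v ((x : L) / (ϖ : L) ^ n) to ℝ using h2 with a
    norm_cast at h1 ⊢
    linarith
  obtain ⟨u, hu⟩ := (V.isUnit_integers_iff ⟨_, hq.ge⟩).2 hq
  refine ⟨n, u, hn, ?_⟩
  ext
  rw [hu]
  simp [mul_div_cancel₀ _ (pow_ne_zero n hϖ0)]

lemma HasIndex.exists_uniformizer {e : ℕ} (h : V.HasIndex e) :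
    ∃ ϖ : V.integers, V.v (ϖ : L) = ((1 / (e : ℝ) : ℝ) : WithTop ℝ) := by
  obtain ⟨x, hx⟩ := h.2.2
  refine ⟨⟨x, ?_⟩, hx⟩
  rw [mem_integers, hx]
  exact_mod_cast h.one_div_pos.le

lemma HasIndex.maximalIdeal_eq {e : ℕ} (h : V.HasIndex e) {ϖ : V.integers}
    (hϖ : V.v (ϖ : L) = ((1 / (e : ℝ) : ℝ) : WithTop ℝ)) :
    IsLocalRing.maximalIdeal V.integers = Ideal.span {ϖ} := by
  ext x
  rw [mem_maximalIdeal_iff, Ideal.mem_span_singleton]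
  constructor
  · intro hx
    by_cases h0 : x = 0
    · simp [h0]
    obtain ⟨n, u, hn, hu⟩ := h.uniformizer_spec hϖ x h0
    have hn0 : n ≠ 0 := by rintro rfl; simp [hn] at hx
    rw [hu]
    exact Dvd.dvd.mul_right (dvd_pow_self _ hn0) _
  · rintro ⟨y, rfl⟩
    have : V.v ((ϖ * y : V.integers) : L) = V.v (ϖ : L) + V.v (y : L) := by
      rw [← V.v_mul]; rfl
    rw [this, hϖ]
    exact add_pos_of_pos_of_nonneg (by exact_mod_cast h.one_div_pos) y.2

lemma HasIndex.isDiscreteValuationRing {e : ℕ} (h : V.HasIndex e) :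
    IsDiscreteValuationRing V.integers := by
  obtain ⟨ϖ, hϖ⟩ := h.exists_uniformizer
  have hϖ0 : ϖ ≠ 0 := by rintro rfl; simp [V.v_zero] at hϖ
  refine IsDiscreteValuationRing.ofHasUnitMulPowIrreducibleFactorization ⟨ϖ, ?_, ?_⟩
  · have hm := h.maximalIdeal_eq hϖ
    have hp : Prime ϖ := by
      rw [← Ideal.span_singleton_prime hϖ0, ← hm]
      infer_instance
    exact hp.irreducible
  · intro x hx
    obtain ⟨n, u, -, hu⟩ := h.uniformizer_spec hϖ x hx
    exact ⟨n, u, hu.symm⟩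

end AddVal

namespace AddVal

section Conjugation

variable {K L : Type*} [Field K] [Field L] (V : AddVal L)

lemma lt_v_sum {ι : Type*} (s : Finset ι) (f : ι → L)
    (h : ∀ j ∈ s, 0 < V.v (f j)) : 0 < V.v (∑ j ∈ s, f j) := by
  induction s using Finset.induction_on with
  | empty => simp [V.v_zero]
  | insert a s ha ih =>
    rw [Finset.sum_insert ha]
    exact V.lt_v_add (h a (by simp)) (ih fun j hj => h j (by simp [hj]))

lemma coeff_mul_nonneg {p q : Polynomial L} (hp : ∀ n, 0 ≤ V.v (p.coeff n))
    (hq : ∀ n, 0 ≤ V.v (q.coeff n)) (n : ℕ) : 0 ≤ V.v ((p * q).coeff n) := by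
  rw [Polynomial.coeff_mul]
  refine V.le_v_sum _ _ fun j _ => ?_
  rw [V.v_mul]
  exact add_nonneg (hp _) (hq _)

lemma coeff_prod_X_sub_C_nonneg {ι : Type*} (s : Finset ι) (f : ι → L)
    (hf : ∀ j ∈ s, 0 ≤ V.v (f j)) (n : ℕ) :
    0 ≤ V.v ((∏ j ∈ s, (Polynomial.X - Polynomial.C (f j))).coeff n) := by
  induction s using Finset.induction_on generalizing n with
  | empty =>
    rw [Finset.prod_empty, Polynomial.coeff_one]
    split_ifs <;> simp [V.v_one, V.v_zero]
  | insert a s ha ih =>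
    rw [Finset.prod_insert ha]
    refine V.coeff_mul_nonneg (fun m => ?_) (ih fun j hj => hf j (by simp [hj])) n
    rw [Polynomial.coeff_sub]
    refine V.le_v_sub ?_ ?_
    · rw [Polynomial.coeff_X]; split_ifs <;> simp [V.v_one, V.v_zero]
    · rw [Polynomial.coeff_C]
      split_ifs
      · exact hf a (by simp)
      · simp [V.v_zero]

/-- The absolute value `exp (-v)` attached to an additive valuation. -/
def abv : AbsoluteValue L ℝ where
  toFun x := if x = 0 then 0 else Real.exp (-(V.v x).untopD 0)
  map_mul' x y := by
    by_cases hx : x = 0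
    · simp [hx]
    by_cases hy : y = 0
    · simp [hy]
    have h1 := V.v_ne_top x hx
    have h2 := V.v_ne_top y hy
    simp only [hx, hy, mul_eq_zero, or_self, if_false, V.v_mul, ← Real.exp_add]
    lift V.v x to ℝ using h1 with a
    lift V.v y to ℝ using h2 with b
    rw [← WithTop.coe_add]
    simp only [WithTop.untopD_coe]
    ring_nf
  nonneg' x := by
    split_ifs
    · exact le_rfl
    · exact (Real.exp_pos _).le
  eq_zero' x := by
    by_cases hx : x = 0
    · simp [hx]
    · simp [hx, Real.exp_ne_zero]
  add_le' x y := by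
    by_cases hx : x = 0
    · simp [hx]
    by_cases hy : y = 0
    · simp [hy]
    by_cases hxy : x + y = 0
    · simp only [hx, hy, hxy, if_true, if_false]; positivity
    have h1 := V.v_ne_top x hx
    have h2 := V.v_ne_top y hy
    have h3 := V.v_ne_top _ hxy
    have h := V.v_min_le_add x y
    simp only [hx, hy, hxy, if_false]
    lift V.v x to ℝ using h1 with a
    lift V.v y to ℝ using h2 with b
    lift V.v (x + y) to ℝ using h3 with c
    simp only [WithTop.untopD_coe]
    have h' : min a b ≤ c := by exact_mod_cast h
    rcases min_le_iff.1 h' with h | h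
    · have := Real.exp_le_exp.2 (neg_le_neg h)
      have := Real.exp_pos (-b)
      linarith
    · have := Real.exp_le_exp.2 (neg_le_neg h)
      have := Real.exp_pos (-a)
      linarith

lemma abv_apply_of_eq {x : L} {a : ℝ} (h : V.v x = a) : V.abv x = Real.exp (-a) := by
  have hx : x ≠ 0 := by rintro rfl; simp [V.v_zero] at h
  change (if x = 0 then 0 else Real.exp (-(V.v x).untopD 0)) = _
  simp [hx, h]

lemma abv_lt_one_iff {x : L} : V.abv x < 1 ↔ 0 < V.v x := by
  by_cases hx : x = 0
  · simp [hx, V.v_zero]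
  · obtain ⟨a, ha⟩ := WithTop.ne_top_iff_exists.1 (V.v_ne_top x hx)
    rw [V.abv_apply_of_eq ha.symm, ← ha, Real.exp_lt_one_iff, neg_lt_zero]
    exact_mod_cast Iff.rfl

lemma one_lt_abv_iff {x : L} : 1 < V.abv x ↔ V.v x < 0 := by
  by_cases hx : x = 0
  · simp [hx, V.v_zero]
  · obtain ⟨a, ha⟩ := WithTop.ne_top_iff_exists.1 (V.v_ne_top x hx)
    rw [V.abv_apply_of_eq ha.symm, ← ha, Real.one_lt_exp_iff, neg_pos]
    exact_mod_cast Iff.rfl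

lemma v_eq_of_abv_eq {V W : AddVal L} (h : V.abv = W.abv) (x : L) : V.v x = W.v x := by
  by_cases hx : x = 0
  · simp [hx, V.v_zero, W.v_zero]
  · obtain ⟨a, ha⟩ := WithTop.ne_top_iff_exists.1 (V.v_ne_top x hx)
    obtain ⟨b, hb⟩ := WithTop.ne_top_iff_exists.1 (W.v_ne_top x hx)
    have := DFunLike.congr_fun h x
    rw [V.abv_apply_of_eq ha.symm, W.abv_apply_of_eq hb.symm, Real.exp_eq_exp, neg_inj] at this
    rw [← ha, ← hb, this]

end Conjugation

section Henselian

variable {F M : Type*} [Field F] [Field M] [Algebra F M] [FiniteDimensional F M] [IsGalois F M]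
  {V : AddVal M}

/-- The valuation `x ↦ V (γ x)`. -/
abbrev conj (V : AddVal M) (γ : M ≃ₐ[F] M) : AddVal M := V.comap (γ : M →+* M)

omit [FiniteDimensional F M] [IsGalois F M] in
lemma conj_abv_eq_of_isEquiv (hnorm : V.IsNormalizedOn F) (γ δ : M ≃ₐ[F] M)
    (h : (V.conj γ).abv.IsEquiv (V.conj δ).abv) : (V.conj γ).abv = (V.conj δ).abv := by
  obtain ⟨c, hc, hcc⟩ := AbsoluteValue.isEquiv_iff_exists_rpow_eq.1 h
  obtain ⟨x, hx⟩ := hnorm.2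
  have h1 : ∀ γ : M ≃ₐ[F] M, (V.conj γ).abv (algebraMap F M x) = Real.exp (-1) := by
    intro γ
    apply abv_apply_of_eq
    simp only [comap_v, RingHom.coe_coe, AlgEquiv.commutes]
    exact hx
  have h2 := congrFun hcc (algebraMap F M x)
  simp only [h1] at h2
  rw [← Real.exp_mul, Real.exp_eq_exp] at h2
  have hc1 : c = 1 := by linarith
  subst hc1
  ext y
  simpa using congrFun hcc y

omit [IsGalois F M] in
/-- If `V` is not Galois invariant, then its distinct conjugates can be separated. -/
lemma exists_separating (hnorm : V.IsNormalizedOn F) :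
    ∃ z : M, 0 < V.v (z - 1) ∧
      ∀ γ : M ≃ₐ[F] M, (∃ x, V.v (γ x) ≠ V.v x) → 0 < V.v (γ z) := by
  let ι := Set.range fun γ : M ≃ₐ[F] M => (V.conj γ).abv
  let i₀ : ι := ⟨(V.conj (1 : M ≃ₐ[F] M)).abv, 1, rfl⟩
  have : Fintype ι := Fintype.ofFinite ι
  obtain ⟨a, ha, hb⟩ := AbsoluteValue.exists_one_lt_lt_one_pi_of_not_isEquiv
    (v := fun j : ι => j.1) (by
      rintro ⟨_, γ, rfl⟩
      obtain ⟨x, hx⟩ := hnorm.2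
      refine ⟨algebraMap F M x, ?_, ?_⟩
      · intro h; rw [h, V.v_zero] at hx; simp at hx
      · refine ne_of_lt ?_
        simp only
        rw [abv_lt_one_iff]
        simp only [comap_v, RingHom.coe_coe, AlgEquiv.commutes]
        rw [hx]; exact_mod_cast one_pos)
    (by
      rintro ⟨_, γ, rfl⟩ ⟨_, δ, rfl⟩ hne h
      exact hne (Subtype.ext (conj_abv_eq_of_isEquiv hnorm γ δ h))) i₀
  have ha' : V.v a < 0 := by
    have := (one_lt_abv_iff _).1 ha
    simpa using this
  have ha1 : V.v (1 + a) = V.v a := by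
    rw [add_comm]; exact V.v_add_eq_of_lt (by simpa [V.v_one] using ha')
  have h10 : 1 + a ≠ 0 := by intro h; rw [h, V.v_zero] at ha1; simp [← ha1] at ha'
  refine ⟨a / (1 + a), ?_, ?_⟩
  · have h2 : a / (1 + a) - 1 = -(1 + a)⁻¹ := by field_simp; ring
    rw [h2, V.v_neg]
    have h3 := V.v_inv_add (1 + a) h10
    have h4 := V.v_ne_top _ h10
    have h5 := V.v_ne_top _ (inv_ne_zero h10)
    rw [← ha1] at ha'
    lift V.v (1 + a) to ℝ using h4 with b
    lift V.v (1 + a)⁻¹ to ℝ using h5 with c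
    norm_cast at *
    linarith
  · rintro γ ⟨x, hx⟩
    have h2 : 0 < V.v (γ a) := by
      have := hb ⟨(V.conj γ).abv, γ, rfl⟩ (by
        intro h
        have h' := congrArg Subtype.val h
        exact hx (by simpa using v_eq_of_abv_eq h' x))
      exact (abv_lt_one_iff (V.conj γ)).1 this
    have h3 : V.v (1 + γ a) = 0 := by
      rw [← V.v_one]
      exact V.v_add_eq_of_lt (by rwa [V.v_one])
    rw [map_div₀, map_add, map_one, div_eq_mul_inv, V.v_mul, V.v_inv_nonneg h3, add_zero]
    exact h2

lemma minpoly_map_eq_prod (b : M) : (minpoly F b).map (algebraMap F M) =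
    ∏ r ∈ ((minpoly F b).aroots M).toFinset, (Polynomial.X - Polynomial.C r) := by
  have hsep : (minpoly F b).Separable := IsGalois.separable F b
  have hspl := IsGalois.splits F b
  have hnd : ((minpoly F b).aroots M).Nodup := Polynomial.nodup_roots hsep.map
  rw [Finset.prod, Multiset.toFinset_val, hnd.dedup]
  exact hspl.eq_prod_roots_of_monic ((minpoly.monic (IsIntegral.of_finite F b)).map _)

/-- The valuation of a Henselian field extends uniquely, so it is Galois invariant. -/
theorem v_algEquiv (hnorm : V.IsNormalizedOn F) (hhens : V.IsHenselianOn F)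
    (γ : M ≃ₐ[F] M) (x : M) : V.v (γ x) = V.v x := by
  by_contra hγ
  obtain ⟨z, hz1, hz⟩ := exists_separating (F := F) hnorm
  let D : Subgroup (M ≃ₐ[F] M) :=
    { carrier := {γ | ∀ x, V.v (γ x) = V.v x}
      mul_mem' := fun {a b} ha hb x => by
        rw [AlgEquiv.mul_apply, ha, hb]
      one_mem' := fun x => rfl
      inv_mem' := fun {a} ha x => by
        rw [← ha (a⁻¹ x), ← AlgEquiv.mul_apply, mul_inv_cancel, AlgEquiv.one_apply] }
  have hD : ∀ {γ : M ≃ₐ[F] M}, γ ∉ D → 0 < V.v (γ z) := fun {γ} h => by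
    refine hz γ ?_
    by_contra! hc
    exact h hc
  have hγD : γ ∉ D := fun h => hγ (h x)
  have hz0 : V.v z = 0 := V.v_eq_zero_of_sub V.v_one hz1
  let b : M := ∏ τ : D, (τ : M ≃ₐ[F] M) z
  have hbfix : ∀ δ ∈ D, δ b = b := by
    intro δ hδ
    change δ (∏ τ : D, (τ : M ≃ₐ[F] M) z) = _
    rw [map_prod]
    exact Fintype.prod_equiv (Equiv.mulLeft (⟨δ, hδ⟩ : D)) _ _ fun τ => rfl
  have hb1 : 0 < V.v (b - 1) := by
    have key : ∀ s : Finset D, 0 < V.v (∏ τ ∈ s, (τ : M ≃ₐ[F] M) z - 1) := by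
      intro s
      induction s using Finset.induction_on with
      | empty => simp [V.v_zero]
      | insert a s ha ih =>
        rw [Finset.prod_insert ha]
        have h1 : 0 < V.v ((a : M ≃ₐ[F] M) z - 1) := by
          have := a.2 (z - 1)
          rw [map_sub, map_one] at this
          rwa [this]
        have h2 : (a : M ≃ₐ[F] M) z * ∏ τ ∈ s, (τ : M ≃ₐ[F] M) z - 1 =
            (a : M ≃ₐ[F] M) z * (∏ τ ∈ s, (τ : M ≃ₐ[F] M) z - 1) +
              ((a : M ≃ₐ[F] M) z - 1) := by ring
        rw [h2]
        refine V.lt_v_add ?_ h1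
        rw [V.v_mul, a.2 z, hz0, zero_add]
        exact ih
    exact key Finset.univ
  have hb0 : V.v b = 0 := V.v_eq_zero_of_sub V.v_one hb1
  have hbσ : ∀ σ : M ≃ₐ[F] M, σ ∉ D → 0 < V.v (σ b) := by
    intro σ hσ
    change 0 < V.v (σ (∏ τ : D, (τ : M ≃ₐ[F] M) z))
    rw [map_prod, V.v_prod, ← Finset.add_sum_erase _ _ (Finset.mem_univ (1 : D))]
    refine add_pos_of_pos_of_nonneg (hD hσ) (Finset.sum_nonneg fun τ _ => ?_)
    refine (hD (γ := σ * τ) fun h => hσ ?_).le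
    have := D.mul_mem h (D.inv_mem τ.2)
    rwa [mul_inv_cancel_right] at this
  have hbD : ∀ σ : M ≃ₐ[F] M, σ b ≠ b → 0 < V.v (σ b) := fun σ h =>
    hbσ σ fun hσ => h (hbfix σ hσ)
  have hint : IsIntegral F b := IsIntegral.of_finite F b
  have hroot : ∀ r ∈ ((minpoly F b).aroots M).toFinset, r ≠ b → 0 < V.v r := by
    intro r hr hrb
    rw [Multiset.mem_toFinset, Polynomial.mem_aroots] at hr
    obtain ⟨σ, rfl⟩ := minpoly.exists_algEquiv_of_root' hint.isAlgebraic hr.2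
    exact hbD σ hrb
  have hroot' : ∀ r ∈ ((minpoly F b).aroots M).toFinset, 0 ≤ V.v r := by
    intro r hr
    by_cases h : r = b
    · rw [h, hb0]
    · exact (hroot r hr h).le
  have hbmem : b ∈ ((minpoly F b).aroots M).toFinset := by
    rw [Multiset.mem_toFinset, Polynomial.mem_aroots]
    exact ⟨minpoly.ne_zero hint, minpoly.aeval F b⟩
  have hprod := minpoly_map_eq_prod (F := F) b
  obtain ⟨a, ha, ha1⟩ := hhens (minpoly F b) (fun n => by
      rw [← Polynomial.coeff_map, hprod]
      exact V.coeff_prod_X_sub_C_nonneg _ _ hroot' n) 1 (by simp [V.v_one])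
    (by
      rw [← Polynomial.eval_map_apply, hprod, map_one, Polynomial.eval_prod, V.v_prod,
        ← Finset.add_sum_erase _ _ hbmem]
      simp only [Polynomial.eval_sub, Polynomial.eval_X, Polynomial.eval_C]
      refine add_pos_of_pos_of_nonneg (by rwa [V.v_sub_comm]) (Finset.sum_nonneg fun r hr => ?_)
      exact V.le_v_sub V.v_one.ge (hroot' r (Finset.mem_of_mem_erase hr)))
    (by
      rw [← Polynomial.eval_map_apply, ← Polynomial.derivative_map, hprod, map_one,
        Polynomial.derivative_prod_finset, Polynomial.eval_finsetSum,
        ← Finset.add_sum_erase _ _ hbmem]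
      simp only [Polynomial.derivative_X_sub_C, mul_one, Polynomial.eval_prod,
        Polynomial.eval_sub, Polynomial.eval_X, Polynomial.eval_C]
      refine V.v_eq_zero_of_sub (y := ∏ r ∈ ((minpoly F b).aroots M).toFinset.erase b, (1 - r)) ?_ ?_
      · rw [V.v_prod]
        refine Finset.sum_eq_zero fun r hr => ?_
        refine V.v_eq_zero_of_sub V.v_one ?_
        rw [sub_sub_cancel_left, V.v_neg]
        exact hroot r (Finset.mem_of_mem_erase hr) (Finset.ne_of_mem_erase hr)
      · rw [add_sub_cancel_left]
        refine V.lt_v_sum _ _ fun r hr => ?_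
        rw [V.v_prod, ← Finset.add_sum_erase _ _ (Finset.mem_erase.2
          ⟨(Finset.ne_of_mem_erase hr).symm, hbmem⟩)]
        refine add_pos_of_pos_of_nonneg (by rwa [V.v_sub_comm])
          (Finset.sum_nonneg fun r hr => ?_)
        exact V.le_v_sub V.v_one.ge
          (hroot' r (Finset.mem_of_mem_erase (Finset.mem_of_mem_erase hr))))
  have ha2 : Polynomial.aeval (algebraMap F M a) (minpoly F b) = 0 := by
    rw [Polynomial.aeval_algebraMap_apply, Polynomial.aeval_def, Polynomial.eval₂_eq_eval_map]
    simp [ha]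
  obtain ⟨σ, hσ⟩ := minpoly.exists_algEquiv_of_root' hint.isAlgebraic ha2
  have hba : b = algebraMap F M a := by
    rw [← σ.symm_apply_apply b, hσ, AlgEquiv.commutes]
  have := hbσ γ hγD
  rw [hba, AlgEquiv.commutes, ← hba, hb0] at this
  exact lt_irrefl _ this

end Henselian
end AddVal

namespace AddVal

section Extension

variable {K M : Type*} [Field K] [Field M] [Algebra K M] (V : AddVal M)

instance integersAlgebra : Algebra (V.comap (algebraMap K M)).integers V.integers :=
  RingHom.toAlgebra
    ((algebraMap K M).restrict (V.comap (algebraMap K M)).integers V.integers fun _ hx => hx)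

instance integers_isScalarTower :
    IsScalarTower (V.comap (algebraMap K M)).integers V.integers M :=
  IsScalarTower.of_algebraMap_eq fun _ => rfl

lemma coe_algebraMap_integers (x : (V.comap (algebraMap K M)).integers) :
    ((algebraMap (V.comap (algebraMap K M)).integers V.integers x : V.integers) : M) =
      algebraMap K M (x : K) := rfl

instance integers_isLocalHom :
    IsLocalHom (algebraMap (V.comap (algebraMap K M)).integers V.integers) :=
  ⟨fun x h => by rw [isUnit_integers_iff] at *; exact h⟩

lemma integers_algebraMap_injective :
    Function.Injective (algebraMap (V.comap (algebraMap K M)).integers V.integers) := by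
  intro x y h
  have := congrArg (Subtype.val) h
  rw [coe_algebraMap_integers, coe_algebraMap_integers] at this
  exact Subtype.ext ((algebraMap K M).injective this)

variable {V}

lemma isIntegral_of_coeff_minpoly {x : M} (hx : IsIntegral K x)
    (h : ∀ n, 0 ≤ V.v (algebraMap K M ((minpoly K x).coeff n))) :
    IsIntegral (V.comap (algebraMap K M)).integers x := by
  have hl : minpoly K x ∈ Polynomial.lifts (algebraMap (V.comap (algebraMap K M)).integers K) := by
    rw [Polynomial.lifts_iff_coeff_lifts]
    exact fun n => ⟨⟨_, h n⟩, rfl⟩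
  obtain ⟨q, hq, -, hmon⟩ :=
    Polynomial.lifts_and_natDegree_eq_and_monic hl (minpoly.monic hx)
  refine ⟨q, hmon, ?_⟩
  rw [← Polynomial.aeval_def, ← Polynomial.aeval_map_algebraMap K, hq, minpoly.aeval]

lemma coeff_minpoly_nonneg [FiniteDimensional K M] [IsGalois K M]
    (hinv : ∀ (γ : M ≃ₐ[K] M) x, V.v (γ x) = V.v x) {x : M} (hx : 0 ≤ V.v x) (n : ℕ) :
    0 ≤ V.v (algebraMap K M ((minpoly K x).coeff n)) := by
  rw [← Polynomial.coeff_map, minpoly_map_eq_prod]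
  refine V.coeff_prod_X_sub_C_nonneg _ _ (fun r hr => ?_) n
  rw [Multiset.mem_toFinset, Polynomial.mem_aroots] at hr
  obtain ⟨σ, rfl⟩ := minpoly.exists_algEquiv_of_root'
    (IsIntegral.of_finite K x).isAlgebraic hr.2
  rwa [hinv]

lemma integers_isIntegralClosure [FiniteDimensional K M] [IsGalois K M]
    (hinv : ∀ (γ : M ≃ₐ[K] M) x, V.v (γ x) = V.v x) :
    IsIntegralClosure V.integers (V.comap (algebraMap K M)).integers M where
  algebraMap_injective := Subtype.val_injective
  isIntegral_iff {x} := by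
    constructor
    · intro hx
      have : IsIntegral V.integers x := hx.tower_top
      exact IsIntegrallyClosed.isIntegral_iff.1 this
    · rintro ⟨y, rfl⟩
      exact isIntegral_of_coeff_minpoly (IsIntegral.of_finite K _) (coeff_minpoly_nonneg hinv y.2)

lemma perfectField_residueField (hperf : V.HasPerfectResidueFieldOn K) :
    PerfectField (IsLocalRing.ResidueField (V.comap (algebraMap K M)).integers) := by
  set A := (V.comap (algebraMap K M)).integers with hA
  obtain ⟨p, hp⟩ := CharP.exists (IsLocalRing.ResidueField A)
  rcases CharP.char_is_prime_or_zero (IsLocalRing.ResidueField A) p with hpp | rfl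
  · have : Fact p.Prime := ⟨hpp⟩
    have hval : 0 < V.v (algebraMap K M (p : K)) := by
      have h1 : IsLocalRing.residue A (p : A) = 0 := by
        rw [map_natCast, CharP.cast_eq_zero]
      rw [IsLocalRing.residue_eq_zero_iff, mem_maximalIdeal_iff] at h1
      simpa using h1
    have : PerfectRing (IsLocalRing.ResidueField A) p := by
      refine PerfectRing.ofSurjective _ p fun x => ?_
      obtain ⟨x, rfl⟩ := IsLocalRing.residue_surjective x
      obtain ⟨y, hy, hxy⟩ := hperf p hpp hval x x.2
      refine ⟨IsLocalRing.residue A ⟨y, hy⟩, ?_⟩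
      rw [frobenius_def, ← map_pow, eq_comm, ← sub_eq_zero, ← map_sub,
        IsLocalRing.residue_eq_zero_iff, mem_maximalIdeal_iff]
      exact hxy
    exact PerfectRing.toPerfectField _ p
  · have : CharZero (IsLocalRing.ResidueField A) := CharP.charP_to_charZero _
    exact PerfectField.ofCharZero

lemma perfectField_residueField_of_isIntegral
    [Algebra.IsIntegral (V.comap (algebraMap K M)).integers V.integers]
    (hperf : V.HasPerfectResidueFieldOn K) :
    PerfectField (IsLocalRing.ResidueField V.integers) := by
  have := perfectField_residueField hperf
  have : Algebra.IsIntegral (IsLocalRing.ResidueField (V.comap (algebraMap K M)).integers)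
      (IsLocalRing.ResidueField V.integers) := by
    refine ⟨fun x => ?_⟩
    obtain ⟨b, rfl⟩ := IsLocalRing.residue_surjective x
    exact ((Algebra.IsIntegral.isIntegral (R := (V.comap (algebraMap K M)).integers) b).map
      (IsScalarTower.toAlgHom (V.comap (algebraMap K M)).integers V.integers
        (IsLocalRing.ResidueField V.integers))).tower_top
  exact Algebra.IsAlgebraic.perfectField
    (IsLocalRing.ResidueField (V.comap (algebraMap K M)).integers)

/-- The order of the inertia group times the ramification index of the base. -/
theorem card_inertia_mul [FiniteDimensional K M] [IsGalois K M]
    (hinv : ∀ (γ : M ≃ₐ[K] M) x, V.v (γ x) = V.v x) {eK eM : ℕ}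
    (hK : (V.comap (algebraMap K M)).HasIndex eK) (hM : V.HasIndex eM)
    [hperf : PerfectField (IsLocalRing.ResidueField (V.comap (algebraMap K M)).integers)] :
    Nat.card {γ : M ≃ₐ[K] M // ∀ x, 0 ≤ V.v x → 0 < V.v (γ x - x)} * eK = eM := by
  let A := (V.comap (algebraMap K M)).integers
  let B := V.integers
  have : IsDiscreteValuationRing A := hK.isDiscreteValuationRing
  have : IsDiscreteValuationRing B := hM.isDiscreteValuationRing
  have : IsIntegralClosure B A M := integers_isIntegralClosure hinv
  have : Module.Finite A B := IsIntegralClosure.finite A K M B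
  let : MulSemiringAction (M ≃ₐ[K] M) B := IsIntegralClosure.MulSemiringAction A K M B
  have : IsGaloisGroup (M ≃ₐ[K] M) A B := IsGaloisGroup.of_isFractionRing _ _ _ K M
  have : Module.IsTorsionFree A B :=
    Module.isTorsionFree_iff_algebraMap_injective.2 V.integers_algebraMap_injective
  have : PerfectField (IsLocalRing.maximalIdeal A).ResidueField :=
    PerfectField.of_ringEquiv (RingEquiv.ofBijective
      (algebraMap (A ⧸ IsLocalRing.maximalIdeal A) (IsLocalRing.maximalIdeal A).ResidueField)
      (Ideal.bijective_algebraMap_quotient_residueField _)) (K := IsLocalRing.ResidueField A)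
  have h1 := Ideal.card_inertia_eq_ramificationIdxIn (G := M ≃ₐ[K] M)
    (IsLocalRing.maximalIdeal A) (IsLocalRing.maximalIdeal B)
  rw [Ideal.ramificationIdxIn_eq_ramificationIdx (IsLocalRing.maximalIdeal A)
    (IsLocalRing.maximalIdeal B) (M ≃ₐ[K] M)] at h1
  obtain ⟨ϖA, hϖA⟩ := hK.exists_uniformizer
  obtain ⟨ϖB, hϖB⟩ := hM.exists_uniformizer
  have hA0 : ϖA ≠ 0 := by rintro rfl; simp [V.v_zero] at hϖA
  have hA0' : algebraMap A B ϖA ≠ 0 := by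
    rwa [Ne, map_eq_zero_iff _ V.integers_algebraMap_injective]
  obtain ⟨n, u, hn, hu⟩ := hM.uniformizer_spec hϖB (algebraMap A B ϖA) hA0'
  have hmap : (IsLocalRing.maximalIdeal A).map (algebraMap A B) = IsLocalRing.maximalIdeal B ^ n := by
    rw [hK.maximalIdeal_eq hϖA, hM.maximalIdeal_eq hϖB, Ideal.map_span, Set.image_singleton,
      Ideal.span_singleton_pow, Ideal.span_singleton_eq_span_singleton]
    exact Associated.symm ⟨u, hu.symm⟩
  have hB0 : IsLocalRing.maximalIdeal B ≠ ⊥ := IsDiscreteValuationRing.not_a_field B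
  rw [Ideal.IsDedekindDomain.ramificationIdx_eq_multiplicity (IsLocalRing.maximalIdeal A) _ (by
    rw [hmap]; exact pow_ne_zero n hB0), hmap, multiplicity_pow_self hB0 (by
      rw [Ideal.isUnit_iff]; exact (IsLocalRing.maximalIdeal.isMaximal B).ne_top)] at h1
  have hcard : Nat.card {γ : M ≃ₐ[K] M // ∀ x, 0 ≤ V.v x → 0 < V.v (γ x - x)} = n := by
    rw [← h1]
    refine Nat.card_congr (Equiv.subtypeEquivRight fun γ => ?_)
    have hsm : ∀ x : B, ((γ • x : B) : M) = γ x := fun x => algebraMap.smul' (B := B) (C := M) γ x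
    have hmem : ∀ x : B, γ • x - x ∈ IsLocalRing.maximalIdeal B ↔ 0 < V.v (γ (x : M) - x) := by
      intro x
      rw [mem_maximalIdeal_iff, ← hsm]
      rfl
    exact ⟨fun h x => (hmem x).2 (h x x.2), fun h x hx => (hmem ⟨x, hx⟩).1 (h ⟨x, hx⟩)⟩
  rw [hcard]
  have : V.v (algebraMap K M ϖA) = ((1 / (eK : ℝ) : ℝ) : WithTop ℝ) := hϖA
  rw [coe_algebraMap_integers, this] at hn
  have h2 : (1 : ℝ) / eK = n / eM := by exact_mod_cast hn
  have he1 : (eK : ℝ) ≠ 0 := by exact_mod_cast hK.1.ne'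
  have he2 : (eM : ℝ) ≠ 0 := by exact_mod_cast hM.1.ne'
  field_simp at h2
  rw [mul_comm]
  exact_mod_cast h2.symm

end Extension
end AddVal

namespace AddVal

section Monogenic

variable {K M : Type*} [Field K] [Field M] [Algebra K M] {V : AddVal M}

/-- The ring of integers is monogenic over that of a subfield with perfect residue field. -/
theorem exists_integers_generator [FiniteDimensional K M] [IsGalois K M]
    (hinv : ∀ (γ : M ≃ₐ[K] M) x, V.v (γ x) = V.v x) {eK eM : ℕ}
    (hK : (V.comap (algebraMap K M)).HasIndex eK) (hM : V.HasIndex eM)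
    [hperf : PerfectField (IsLocalRing.ResidueField (V.comap (algebraMap K M)).integers)] :
    ∃ x : V.integers, ∀ y : V.integers,
      ∃ p : Polynomial (V.comap (algebraMap K M)).integers, Polynomial.aeval x p = y := by
  let A := (V.comap (algebraMap K M)).integers
  let B := V.integers
  have : IsDiscreteValuationRing A := hK.isDiscreteValuationRing
  have : IsDiscreteValuationRing B := hM.isDiscreteValuationRing
  have : IsIntegralClosure B A M := integers_isIntegralClosure hinv
  have : Module.Finite A B := IsIntegralClosure.finite A K M B
  obtain ⟨xbar, hxbar⟩ := Field.exists_primitive_element (IsLocalRing.ResidueField A)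
    (IsLocalRing.ResidueField B)
  have hint : IsIntegral (IsLocalRing.ResidueField A) xbar := IsIntegral.of_finite _ _
  have hgen : ∀ z : IsLocalRing.ResidueField B, ∃ q : Polynomial (IsLocalRing.ResidueField A),
      Polynomial.aeval xbar q = z := by
    intro z
    have hz : z ∈ IntermediateField.adjoin (IsLocalRing.ResidueField A) {xbar} := by
      rw [hxbar]; trivial
    rw [← IntermediateField.mem_toSubalgebra,
      IntermediateField.adjoin_simple_toSubalgebra_of_isAlgebraic hint.isAlgebraic,
      Algebra.adjoin_singleton_eq_range_aeval] at hz
    exact hz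
  obtain ⟨g, hg⟩ := Polynomial.map_surjective (IsLocalRing.residue A)
    IsLocalRing.residue_surjective (minpoly (IsLocalRing.ResidueField A) xbar)
  have hres : ∀ (x : B) (p : Polynomial A), IsLocalRing.residue B (Polynomial.aeval x p) =
      Polynomial.aeval (IsLocalRing.residue B x) (p.map (IsLocalRing.residue A)) := by
    intro x p
    have h1 := Polynomial.aeval_algebraMap_apply (IsLocalRing.ResidueField B) x p
    rw [← Polynomial.aeval_map_algebraMap (IsLocalRing.ResidueField A)] at h1
    exact h1.symm
  have hpos : ∀ b : B, IsLocalRing.residue B b = 0 ↔ 0 < V.v (b : M) := by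
    intro b
    rw [IsLocalRing.residue_eq_zero_iff, mem_maximalIdeal_iff]
  obtain ⟨ϖ, hϖ⟩ := hM.exists_uniformizer
  have hϖ0 : 0 < V.v (ϖ : M) := by rw [hϖ]; exact_mod_cast hM.one_div_pos
  obtain ⟨x, hx, hgx⟩ : ∃ x : B, IsLocalRing.residue B x = xbar ∧
      V.v ((Polynomial.aeval x g : B) : M) = ((1 / (eM : ℝ) : ℝ) : WithTop ℝ) := by
    obtain ⟨x₀, hx₀⟩ := IsLocalRing.residue_surjective xbar
    have h0 : 0 < V.v ((Polynomial.aeval x₀ g : B) : M) := by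
      rw [← hpos, hres, hx₀, hg, minpoly.aeval]
    rcases (hM.le_of_pos h0).eq_or_lt with h | h
    · exact ⟨x₀, hx₀, h.symm⟩
    refine ⟨x₀ + ϖ, ?_, ?_⟩
    · rw [map_add, hx₀, (hpos ϖ).2 hϖ0, add_zero]
    obtain ⟨k, hk⟩ := Polynomial.binomExpansion (g.map (algebraMap A B)) x₀ ϖ
    have hd : V.v ((Polynomial.aeval x₀ (Polynomial.derivative g) : B) : M) = 0 := by
      rw [← isUnit_integers_iff, ← not_not (a := IsUnit _), ← mem_nonunits_iff,
        ← IsLocalRing.mem_maximalIdeal, ← IsLocalRing.residue_eq_zero_iff, hres, hx₀,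
        ← Polynomial.derivative_map, hg]
      exact (Algebra.IsSeparable.isSeparable (IsLocalRing.ResidueField A) xbar).aeval_derivative_ne_zero
        (minpoly.aeval _ _)
    have hk' : ((Polynomial.aeval (x₀ + ϖ) g : B) : M) =
        (Polynomial.aeval x₀ (Polynomial.derivative g) : B) * ϖ +
          ((Polynomial.aeval x₀ g : B) + (k : M) * ϖ ^ 2) := by
      have : (Polynomial.aeval (x₀ + ϖ) g : B) =
        (Polynomial.aeval x₀ (Polynomial.derivative g) : B) * ϖ +
          ((Polynomial.aeval x₀ g : B) + k * ϖ ^ 2) := by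
        rw [← Polynomial.aeval_map_algebraMap B, Polynomial.coe_aeval_eq_eval, hk,
          Polynomial.derivative_map, ← Polynomial.coe_aeval_eq_eval,
          Polynomial.aeval_map_algebraMap, Polynomial.aeval_map_algebraMap]
        ring
      rw [this]; rfl
    have h1 : V.v ((Polynomial.aeval x₀ (Polynomial.derivative g) : B) * (ϖ : M)) =
        ((1 / (eM : ℝ) : ℝ) : WithTop ℝ) := by rw [V.v_mul, hd, zero_add, hϖ]
    rw [hk', V.v_add_eq_of_lt, h1]
    rw [h1]
    refine V.lt_v_add h ?_
    rw [V.v_mul, v_pow_uniformizer hϖ]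
    refine lt_of_lt_of_le ?_ (le_add_of_nonneg_left k.2)
    have he : (0 : ℝ) < eM := by exact_mod_cast hM.1
    have : (1 : ℝ) / eM < ((2 : ℕ) : ℝ) / eM := by
      rw [div_lt_div_iff_of_pos_right he]; norm_num
    exact_mod_cast this
  refine ⟨x, ?_⟩
  let S : Submodule A B := LinearMap.range (Polynomial.aeval (R := A) x).toLinearMap
  have hstep : ∀ b : B, ∃ (p : Polynomial A) (c : B),
      b = Polynomial.aeval x p + Polynomial.aeval x g * c := by
    intro b
    obtain ⟨q, hq⟩ := hgen (IsLocalRing.residue B b)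
    obtain ⟨p, rfl⟩ := Polynomial.map_surjective (IsLocalRing.residue A)
      IsLocalRing.residue_surjective q
    rw [← hx, ← hres, eq_comm, ← sub_eq_zero, ← map_sub, IsLocalRing.residue_eq_zero_iff,
      hM.maximalIdeal_eq hgx, Ideal.mem_span_singleton] at hq
    obtain ⟨c, hc⟩ := hq
    exact ⟨p, c, by rw [← hc]; ring⟩
  have hsteps : ∀ (n : ℕ) (b : B), ∃ (p : Polynomial A) (c : B),
      b = Polynomial.aeval x p + Polynomial.aeval x g ^ n * c := by
    intro n
    induction n with
    | zero => exact fun b => ⟨0, b, by simp⟩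
    | succ n ih =>
      intro b
      obtain ⟨p, c, hb⟩ := ih b
      obtain ⟨q, d, hc⟩ := hstep c
      refine ⟨p + g ^ n * q, d, ?_⟩
      rw [hb, hc, map_add, map_mul, map_pow]
      ring
  obtain ⟨ϖA, hϖA⟩ := hK.exists_uniformizer
  have hA0 : ϖA ≠ 0 := by rintro rfl; simp [V.v_zero] at hϖA
  have hA0' : algebraMap A B ϖA ≠ 0 := by
    rwa [Ne, map_eq_zero_iff _ V.integers_algebraMap_injective]
  obtain ⟨n, u, hn, hu⟩ := hM.uniformizer_spec hgx (algebraMap A B ϖA) hA0'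
  have htop : (⊤ : Submodule A B) ≤ S := by
    refine Submodule.le_of_le_smul_of_le_jacobson_bot (I := IsLocalRing.maximalIdeal A)
      Module.Finite.fg_top (IsLocalRing.maximalIdeal_le_jacobson _) ?_
    intro b _
    obtain ⟨p, c, hb⟩ := hsteps n b
    rw [Submodule.mem_sup]
    refine ⟨Polynomial.aeval x p, ⟨p, rfl⟩, Polynomial.aeval x g ^ n * c, ?_, hb.symm⟩
    have : Polynomial.aeval x g ^ n * c = ϖA • ((u⁻¹ : Bˣ) * c) := by
      rw [Algebra.smul_def, hu]
      have : (u : B) * (u⁻¹ : Bˣ) = 1 := u.mul_inv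
      linear_combination (-(Polynomial.aeval x g ^ n * c)) * this
    rw [this]
    refine Submodule.smul_mem_smul ?_ trivial
    rw [hK.maximalIdeal_eq hϖA]
    exact Ideal.mem_span_singleton_self _
  intro y
  exact htop (trivial : y ∈ ⊤)

end Monogenic
end AddVal

namespace AddVal

section Displacement

variable {F M : Type*} [Field F] [Field M] [Algebra F M] (V : AddVal M) (x : M)

/-- The displacement `v (γ x - x)` of an element under a Galois automorphism. -/
def displacement (γ : M ≃ₐ[F] M) : WithTop ℝ := V.v (γ x - x)

/-- `x` generates the ring of integers of `M` over that of `F`. -/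
def IsGenerator (F : Type*) [Field F] [Algebra F M] : Prop :=
  0 ≤ V.v x ∧ ∀ y, 0 ≤ V.v y → ∃ p : Polynomial F,
    (∀ n, 0 ≤ V.v (algebraMap F M (p.coeff n))) ∧ Polynomial.aeval x p = y

variable {V x}

lemma exists_isGenerator [FiniteDimensional F M] [IsGalois F M]
    (hinv : ∀ (γ : M ≃ₐ[F] M) x, V.v (γ x) = V.v x) {eF eM : ℕ}
    (hF : (V.comap (algebraMap F M)).HasIndex eF) (hM : V.HasIndex eM)
    (hperf : V.HasPerfectResidueFieldOn F) : ∃ x, V.IsGenerator x F := by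
  have := perfectField_residueField hperf
  obtain ⟨x, hx⟩ := exists_integers_generator hinv hF hM
  refine ⟨x, x.2, fun y hy => ?_⟩
  obtain ⟨p, hp⟩ := hx ⟨y, hy⟩
  refine ⟨p.map (algebraMap _ F), fun n => ?_, ?_⟩
  · rw [Polynomial.coeff_map]
    exact (p.coeff n).2
  · rw [Polynomial.aeval_map_algebraMap]
    have h1 := Polynomial.aeval_algebraMap_apply M x p
    rw [hp] at h1
    exact h1

lemma displacement_one : V.displacement x (1 : M ≃ₐ[F] M) = ⊤ := by
  simp [displacement, V.v_zero]

lemma min_displacement_le (hinv : ∀ (γ : M ≃ₐ[F] M) x, V.v (γ x) = V.v x) (a b : M ≃ₐ[F] M) :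
    min (V.displacement x a) (V.displacement x b) ≤ V.displacement x (a * b) := by
  have h : (a * b) x - x = a (b x - x) + (a x - x) := by
    rw [AlgEquiv.mul_apply, map_sub]; ring
  rw [displacement, displacement, displacement, h]
  refine V.le_v_add ?_ (min_le_left _ _)
  rw [hinv]
  exact min_le_right _ _

lemma displacement_inv (hinv : ∀ (γ : M ≃ₐ[F] M) x, V.v (γ x) = V.v x) (a : M ≃ₐ[F] M) :
    V.displacement x a⁻¹ = V.displacement x a := by
  rw [displacement, displacement, ← hinv a, map_sub, ← AlgEquiv.mul_apply, mul_inv_cancel,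
    AlgEquiv.one_apply, v_sub_comm]

lemma displacement_nonneg (hinv : ∀ (γ : M ≃ₐ[F] M) x, V.v (γ x) = V.v x) (hx : 0 ≤ V.v x)
    (a : M ≃ₐ[F] M) : 0 ≤ V.displacement x a :=
  V.le_v_sub (by rwa [hinv]) hx

lemma v_pow_nonneg {a : M} (ha : 0 ≤ V.v a) (n : ℕ) : 0 ≤ V.v (a ^ n) := by
  rw [V.v_pow]; exact nsmul_nonneg ha n

lemma le_v_eval {c : WithTop ℝ} {p : Polynomial M} (hp : ∀ n, c ≤ V.v (p.coeff n))
    (hx : 0 ≤ V.v x) : c ≤ V.v (p.eval x) := by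
  rw [Polynomial.eval_eq_sum_range]
  refine V.le_v_sum _ _ fun n _ => ?_
  rw [V.v_mul]
  exact (hp n).trans (le_add_of_nonneg_right (v_pow_nonneg hx n))

lemma le_v_pow_sub_pow {a b : M} (ha : 0 ≤ V.v a) (hb : 0 ≤ V.v b) (n : ℕ) :
    V.v (a - b) ≤ V.v (a ^ n - b ^ n) := by
  induction n with
  | zero => simp [V.v_zero]
  | succ n ih =>
    have h : a ^ (n + 1) - b ^ (n + 1) = a * (a ^ n - b ^ n) + (a - b) * b ^ n := by ring
    rw [h]
    refine V.le_v_add ?_ ?_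
    · rw [V.v_mul]; exact ih.trans (le_add_of_nonneg_left ha)
    · rw [V.v_mul]; exact le_add_of_nonneg_right (v_pow_nonneg hb n)

lemma IsGenerator.displacement_le (hx : V.IsGenerator x F)
    (hinv : ∀ (γ : M ≃ₐ[F] M) x, V.v (γ x) = V.v x) (γ : M ≃ₐ[F] M) {y : M} (hy : 0 ≤ V.v y) :
    V.displacement x γ ≤ V.v (γ y - y) := by
  obtain ⟨p, hp, rfl⟩ := hx.2 y hy
  rw [← Polynomial.aeval_algHom_apply, Polynomial.aeval_eq_sum_range,
    Polynomial.aeval_eq_sum_range, ← Finset.sum_sub_distrib]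
  refine V.le_v_sum _ _ fun n _ => ?_
  rw [← smul_sub, Algebra.smul_def, V.v_mul]
  refine le_trans ?_ (le_add_of_nonneg_left (hp n))
  exact le_v_pow_sub_pow (by rw [hinv]; exact hx.1) hx.1 n

lemma IsGenerator.eq_one_of_apply_eq (hx : V.IsGenerator x F)
    (hinv : ∀ (γ : M ≃ₐ[F] M) x, V.v (γ x) = V.v x) {γ : M ≃ₐ[F] M} (h : γ x = x) : γ = 1 := by
  have hint : ∀ y, 0 ≤ V.v y → γ y = y := by
    intro y hy
    have := hx.displacement_le hinv γ hy
    rwa [displacement, h, sub_self, V.v_zero, top_le_iff, V.v_eq_top, sub_eq_zero] at this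
  ext y
  rcases V.integers.mem_or_inv_mem y with hy | hy
  · exact hint y hy
  · have := hint y⁻¹ hy
    rw [map_inv₀] at this
    exact inv_injective this

lemma exists_mul_eq_of_roots {ι : Type*} [Fintype ι] {P : Polynomial M} (a : ι → M)
    (ha : Function.Injective a) (hav : ∀ j, 0 ≤ V.v (a j)) (hP : ∀ n, 0 ≤ V.v (P.coeff n))
    (hroot : ∀ j, P.eval (a j) = 0) :
    ∃ q : Polynomial M, (∀ n, 0 ≤ V.v (q.coeff n)) ∧
      P = (∏ j, (Polynomial.X - Polynomial.C (a j))) * q := by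
  have hinj : Function.Injective (algebraMap V.integers M) := Subtype.val_injective
  obtain ⟨Q, rfl⟩ : ∃ Q : Polynomial V.integers, Q.map (algebraMap V.integers M) = P := by
    have : P ∈ Polynomial.lifts (algebraMap V.integers M) := by
      rw [Polynomial.lifts_iff_coeff_lifts]
      exact fun n => ⟨⟨_, hP n⟩, rfl⟩
    exact this
  have hdvd : (∏ j, (Polynomial.X - Polynomial.C (⟨a j, hav j⟩ : V.integers))) ∣ Q := by
    by_cases hQ : Q = 0
    · simp [hQ]
    change (Multiset.map (fun j => Polynomial.X - Polynomial.C (⟨a j, hav j⟩ : V.integers))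
      Finset.univ.val).prod ∣ Q
    have := (Multiset.prod_X_sub_C_dvd_iff_le_roots hQ
      (Finset.univ.val.map fun j => (⟨a j, hav j⟩ : V.integers))).2 (by
        rw [Multiset.le_iff_subset]
        · intro b hb
          obtain ⟨j, -, rfl⟩ := Multiset.mem_map.1 hb
          rw [Polynomial.mem_roots hQ, Polynomial.IsRoot.def]
          apply hinj
          rw [← Polynomial.eval_map_apply, map_zero]
          exact hroot j
        · refine Finset.univ.nodup.map fun j k h => ha ?_
          exact congrArg Subtype.val h)
    rwa [Multiset.map_map] at this
  obtain ⟨q, hq⟩ := hdvd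
  refine ⟨q.map (algebraMap V.integers M), fun n => ?_, ?_⟩
  · rw [Polynomial.coeff_map]; exact (q.coeff n).2
  · rw [hq, Polynomial.map_mul, Polynomial.map_prod]
    simp only [Polynomial.map_sub, Polynomial.map_X, Polynomial.map_C]
    rfl

variable [FiniteDimensional F M] [IsGalois F M]

/-- Serre's formula: on a subfield, the displacement is the coset sum of displacements. -/
theorem IsGenerator.forall_le_iff (hx : V.IsGenerator x F)
    (hinv : ∀ (γ : M ≃ₐ[F] M) x, V.v (γ x) = V.v x) (E : IntermediateField F M)
    (γ : M ≃ₐ[F] M) (c : WithTop ℝ) :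
    (∀ y ∈ E, 0 ≤ V.v y → c ≤ V.v (γ y - y)) ↔
      c ≤ cosetSum E.fixingSubgroup (V.displacement x) γ := by
  have hprod : ∀ δ : M ≃ₐ[F] M, ((∏ h : E.fixingSubgroup, (Polynomial.X -
      Polynomial.C ((h : M ≃ₐ[F] M) x))).map (δ : M →+* M)) =
      ∏ h : E.fixingSubgroup, (Polynomial.X - Polynomial.C ((δ * h : M ≃ₐ[F] M) x)) := by
    intro δ
    rw [Polynomial.map_prod]
    simp
  have hval : V.v ((∏ h : E.fixingSubgroup, (Polynomial.X -
      Polynomial.C ((γ * h : M ≃ₐ[F] M) x))).eval x) =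
      cosetSum E.fixingSubgroup (V.displacement x) γ := by
    rw [Polynomial.eval_prod, V.v_prod, cosetSum]
    refine Finset.sum_congr rfl fun h _ => ?_
    rw [Polynomial.eval_sub, Polynomial.eval_X, Polynomial.eval_C, displacement, v_sub_comm]
  constructor
  · intro h
    set f := ∏ h : E.fixingSubgroup, (Polynomial.X - Polynomial.C ((h : M ≃ₐ[F] M) x)) with hf
    have hfint : ∀ n, 0 ≤ V.v (f.coeff n) := fun n =>
      V.coeff_prod_X_sub_C_nonneg _ _ (fun h _ => by rw [hinv]; exact hx.1) n
    have hfE : ∀ n, f.coeff n ∈ E := by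
      intro n
      rw [← IsGalois.fixedField_fixingSubgroup E, IntermediateField.mem_fixedField_iff]
      intro δ hδ
      have : f.map (δ : M →+* M) = f := by
        rw [hprod]
        exact Fintype.prod_equiv (Equiv.mulLeft (⟨δ, hδ⟩ : E.fixingSubgroup)) _ _ fun _ => rfl
      have h2 := congrArg (Polynomial.coeff · n) this
      simp only [Polynomial.coeff_map] at h2
      exact h2
    have hroot : f.eval x = 0 := by
      rw [hf, Polynomial.eval_prod]
      refine Finset.prod_eq_zero (Finset.mem_univ 1) ?_
      simp
    rw [← hval, ← hprod, ← sub_zero (Polynomial.eval _ _), ← hroot, ← Polynomial.eval_sub]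
    refine le_v_eval (fun n => ?_) hx.1
    rw [Polynomial.coeff_sub, Polynomial.coeff_map]
    exact h _ (hfE n) (hfint n)
  · intro h y hyE hy
    obtain ⟨p, hp, hpy⟩ := hx.2 y hy
    obtain ⟨q, hq, hpq⟩ := exists_mul_eq_of_roots
      (P := p.map (algebraMap F M) - Polynomial.C y) (V := V)
      (fun h : E.fixingSubgroup => (h : M ≃ₐ[F] M) x) (by
        intro a b hab
        have h1 : ((a : M ≃ₐ[F] M)⁻¹ * b) x = x := by
          rw [AlgEquiv.mul_apply]
          have hab' : (a : M ≃ₐ[F] M) x = (b : M ≃ₐ[F] M) x := hab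
          rw [← hab', ← AlgEquiv.mul_apply, inv_mul_cancel, AlgEquiv.one_apply]
        have := hx.eq_one_of_apply_eq hinv h1
        exact Subtype.ext (inv_mul_eq_one.1 this))
      (fun h => by rw [hinv]; exact hx.1)
      (fun n => by
        rw [Polynomial.coeff_sub, Polynomial.coeff_map]
        refine V.le_v_sub (hp n) ?_
        rw [Polynomial.coeff_C]
        split_ifs
        · exact hy
        · simp [V.v_zero])
      (fun h => by
        have h1 := (IntermediateField.mem_fixingSubgroup_iff E _).1 h.2 y hyE
        rw [Polynomial.eval_sub, Polynomial.eval_C, Polynomial.eval_map_algebraMap]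
        have h2 := Polynomial.aeval_algHom_apply ((h : M ≃ₐ[F] M) : M →ₐ[F] M) x p
        rw [hpy] at h2
        exact sub_eq_zero.2 (h2.trans h1))
    have h2 := congrArg (fun P => (P.map (γ : M →+* M)).eval x) hpq
    simp only [Polynomial.map_sub, Polynomial.map_mul, Polynomial.map_C, Polynomial.map_map,
      Polynomial.eval_sub, Polynomial.eval_mul, Polynomial.eval_C] at h2
    have h3 : (γ : M →+* M).comp (algebraMap F M) = algebraMap F M := by
      ext a; simp
    rw [h3, Polynomial.eval_map_algebraMap, hpy, hprod] at h2
    have h4 : y - γ y = (∏ h : E.fixingSubgroup, (Polynomial.X -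
        Polynomial.C ((γ * h : M ≃ₐ[F] M) x))).eval x * (q.map (γ : M →+* M)).eval x := h2
    rw [v_sub_comm, h4, V.v_mul, hval]
    refine h.trans (le_add_of_nonneg_right (le_v_eval (fun n => ?_) hx.1))
    rw [Polynomial.coeff_map]
    exact (hq n).trans (hinv γ _).ge

end Displacement
end AddVal

namespace AddVal

section Inertia

variable {F M : Type*} [Field F] [Field M] [Algebra F M] {V : AddVal M} {x : M}
  [FiniteDimensional F M] [IsGalois F M]

lemma perfectField_residueField_intermediateField
    (hinv : ∀ (γ : M ≃ₐ[F] M) x, V.v (γ x) = V.v x) (hperf : V.HasPerfectResidueFieldOn F)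
    (E : IntermediateField F M) :
    PerfectField (IsLocalRing.ResidueField (V.comap (algebraMap E M)).integers) := by
  have : Algebra.IsIntegral ((V.comap (algebraMap E M)).comap (algebraMap F E)).integers
      (V.comap (algebraMap E M)).integers := by
    refine ⟨fun y => ?_⟩
    have h := isIntegral_of_coeff_minpoly (V := V.comap (algebraMap E M)) (K := F) (x := (y : E))
      (IsIntegral.of_finite F _) (fun n => by
        have h1 := coeff_minpoly_nonneg hinv (x := algebraMap E M y) y.2 n
        rw [minpoly.algebraMap_eq (algebraMap E M).injective] at h1
        exact h1)
    rw [← isIntegral_algebraMap_iff (B := E) Subtype.val_injective]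
    exact h
  exact perfectField_residueField_of_isIntegral (K := F) hperf

lemma IsGenerator.inertia_sum_mul (hx : V.IsGenerator x F)
    (hinv : ∀ (γ : M ≃ₐ[F] M) x, V.v (γ x) = V.v x) (hperf : V.HasPerfectResidueFieldOn F)
    (E : IntermediateField F M) {e eM : ℕ}
    (hE : (V.comap (algebraMap E M)).HasIndex e) (hM : V.HasIndex eM) :
    (∑ h : E.fixingSubgroup, if ((1 / (eM : ℝ) : ℝ) : WithTop ℝ) ≤ V.displacement x (h : M ≃ₐ[F] M)
      then (1 : ℝ) else 0) * e = eM := by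
  have := perfectField_residueField_intermediateField hinv hperf E
  have h1 := card_inertia_mul (K := E) (V := V) (fun γ y => hinv (γ.restrictScalars F) y) hE hM
  have h2 : Nat.card {γ : M ≃ₐ[E] M // ∀ x, 0 ≤ V.v x → 0 < V.v (γ x - x)} =
      Nat.card {h : E.fixingSubgroup //
        ((1 / (eM : ℝ) : ℝ) : WithTop ℝ) ≤ V.displacement x (h : M ≃ₐ[F] M)} := by
    refine Nat.card_congr
      ((IntermediateField.fixingSubgroupEquiv E).toEquiv.symm.subtypeEquiv fun γ => ?_)
    refine ⟨fun h => hM.le_of_pos (h x hx.1), fun h y hy => ?_⟩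
    have hpos : (0 : WithTop ℝ) < ((1 / (eM : ℝ) : ℝ) : WithTop ℝ) := by
      exact_mod_cast hM.one_div_pos
    exact hpos.trans_le (h.trans (hx.displacement_le hinv _ hy))
  rw [h2, Nat.card_eq_fintype_card, Fintype.card_subtype] at h1
  rw [Finset.sum_boole]
  exact_mod_cast h1

end Inertia

end AddVal

section Herbrand

variable {K Ω : Type*} [Field K] [Field Ω] [Algebra K Ω] {V : AddVal Ω}
  {E : IntermediateField K Ω} {e : ℕ} {P : Type*} [Fintype P] {a : P → WithTop ℝ}

lemma gfun_eq_sum (f : (↥E →ₐ[K] Ω) ≃ P)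
    (ha : ∀ t σ, xiRel V E e t σ E.val ↔ (((t + 1) / (e : ℝ) : ℝ) : WithTop ℝ) ≤ a (f σ)) (t : ℝ) :
    (gfun V E e t : ℝ) =
      ∑ p, if (((t + 1) / (e : ℝ) : ℝ) : WithTop ℝ) ≤ a p then (1 : ℝ) else 0 := by
  rw [gfun, Nat.card_congr (f.subtypeEquiv (q := fun p => (((t + 1) / (e : ℝ) : ℝ) : WithTop ℝ) ≤ a p)
    (ha t)), Nat.card_eq_fintype_card, Fintype.card_subtype, Finset.sum_boole]

lemma herbrand_eq_sum_ramp (f : (↥E →ₐ[K] Ω) ≃ P)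
    (ha : ∀ t σ, xiRel V E e t σ E.val ↔ (((t + 1) / (e : ℝ) : ℝ) : WithTop ℝ) ≤ a (f σ))
    (he : 0 < e) {s : ℝ} (hs : 0 ≤ s) :
    herbrand V E e s = (∑ p, ramp e (a p) s) /
      ∑ p, if ((1 / (e : ℝ) : ℝ) : WithTop ℝ) ≤ a p then (1 : ℝ) else 0 := by
  have he' : (0 : ℝ) < e := by exact_mod_cast he
  simp only [herbrand, gfun_eq_sum f ha, zero_add]
  rw [intervalIntegral.integral_div, intervalIntegral.integral_finsetSum fun p _ =>
    (integral_indicator_eq_ramp he' hs (a p)).1]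
  simp only [(integral_indicator_eq_ramp he' hs _).2]

end Herbrand

namespace AddVal

section Lift

variable {F M : Type*} [Field F] [Field M] [Algebra F M] {V : AddVal M} {x : M}

lemma IsGenerator.displacement_le_conj (hx : V.IsGenerator x F)
    (hinv : ∀ (γ : M ≃ₐ[F] M) x, V.v (γ x) = V.v x) (a γ : M ≃ₐ[F] M) :
    V.displacement x γ ≤ V.displacement x (a * γ * a⁻¹) := by
  have h : (a * γ * a⁻¹) x - x = a (γ (a⁻¹ x) - a⁻¹ x) := by
    rw [map_sub, ← AlgEquiv.mul_apply a a⁻¹, mul_inv_cancel]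
    rfl
  change _ ≤ V.v ((a * γ * a⁻¹) x - x)
  rw [h, hinv]
  exact hx.displacement_le hinv γ (by rw [hinv]; exact hx.1)

end Lift

section Embeddings

variable {F Ω : Type*} [Field F] [Field Ω] [Algebra F Ω] {V : AddVal Ω}
  {E M : IntermediateField F Ω}

lemma exists_algEquiv_lift [Normal F M] (hEM : E ≤ M) (ρ : E →ₐ[F] Ω) (hρ : ∀ y, ρ y ∈ M) :
    ∃ g : M ≃ₐ[F] M, ∀ y : E, ρ y = g ⟨y, hEM y.2⟩ := by
  let ρ' : E →ₐ[F] M := ρ.codRestrict M.toSubalgebra hρ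
  let e := IntermediateField.restrictAlgEquiv hEM
  let φ : IntermediateField.restrict hEM →ₐ[F] M := ρ'.comp e.symm.toAlgHom
  refine ⟨AlgEquiv.ofBijective (φ.liftNormal M) (AlgHom.normal_bijective F M M _), fun y => ?_⟩
  have h := φ.liftNormal_commutes M (e y)
  have h2 : φ (e y) = ρ' y := congrArg ρ' (e.symm_apply_apply y)
  rw [h2] at h
  exact (congrArg Subtype.val h).symm

variable {x : M}

lemma xiRel_iff_le_cosetSum [FiniteDimensional F M] [IsGalois F M] (hEM : E ≤ M)
    (hinv : ∀ (γ : M ≃ₐ[F] M) x, (V.comap (algebraMap M Ω)).v (γ x) =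
      (V.comap (algebraMap M Ω)).v x)
    (hx : (V.comap (algebraMap M Ω)).IsGenerator x F) (e : ℕ) (t : ℝ) {σ τ : E →ₐ[F] Ω}
    {g k : M ≃ₐ[F] M} (hg : ∀ y : E, σ y = g ⟨y, hEM y.2⟩) (hk : ∀ y : E, τ y = k ⟨y, hEM y.2⟩) :
    xiRel V E e t σ τ ↔ (((t + 1) / (e : ℝ) : ℝ) : WithTop ℝ) ≤
      cosetSum (IntermediateField.restrict hEM).fixingSubgroup
        ((V.comap (algebraMap M Ω)).displacement x) (k⁻¹ * g) := by
  rw [← hx.forall_le_iff hinv]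
  have key : ∀ y : E, V.v (σ y - τ y) = (V.comap (algebraMap M Ω)).v
      ((k⁻¹ * g) ⟨y, hEM y.2⟩ - ⟨y, hEM y.2⟩) := by
    intro y
    rw [← hinv k, map_sub, ← AlgEquiv.mul_apply, mul_inv_cancel_left, hg, hk]
    rfl
  constructor
  · intro h y hyE hy
    have hyE' := (IntermediateField.mem_restrict hEM y).1 hyE
    exact (h ⟨y, hyE'⟩ hy).trans (key ⟨y, hyE'⟩).le
  · intro h y hy
    rw [key]
    exact h _ ((IntermediateField.mem_restrict hEM _).2 y.2) hy

lemma xiRel_val_iff_le_displacement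
    (hinv : ∀ (γ : M ≃ₐ[F] M) x, (V.comap (algebraMap M Ω)).v (γ x) =
      (V.comap (algebraMap M Ω)).v x)
    (hx : (V.comap (algebraMap M Ω)).IsGenerator x F) (e : ℕ) (t : ℝ) (γ : M ≃ₐ[F] M) :
    xiRel V M e t (M.val.comp γ.toAlgHom) M.val ↔
      (((t + 1) / (e : ℝ) : ℝ) : WithTop ℝ) ≤ (V.comap (algebraMap M Ω)).displacement x γ :=
  ⟨fun h => h x hx.1, fun h _ hy => h.trans (hx.displacement_le hinv γ hy)⟩

lemma bijective_lift_mul (hEM : E ≤ M) (lift : (E →ₐ[F] Ω) → (M ≃ₐ[F] M))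
    (hlift : ∀ ρ (y : E), ρ y = lift ρ ⟨y, hEM y.2⟩) :
    Function.Bijective fun p : (E →ₐ[F] Ω) × (IntermediateField.restrict hEM).fixingSubgroup =>
      lift p.1 * p.2 := by
  have hfix : ∀ (h : (IntermediateField.restrict hEM).fixingSubgroup) (y : E),
      (h : M ≃ₐ[F] M) ⟨y, hEM y.2⟩ = ⟨y, hEM y.2⟩ := fun h y =>
    (IntermediateField.mem_fixingSubgroup_iff _ _).1 h.2 _
      ((IntermediateField.mem_restrict hEM _).2 y.2)
  constructor
  · rintro ⟨ρ, h⟩ ⟨ρ', h'⟩ heq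
    replace heq : lift ρ * h = lift ρ' * h' := heq
    obtain rfl : ρ = ρ' := by
      ext y
      have := congrArg (fun g : M ≃ₐ[F] M => g ⟨y, hEM y.2⟩) heq
      simp only [AlgEquiv.mul_apply, hfix] at this
      rw [hlift, hlift, this]
    exact congrArg (Prod.mk ρ) (Subtype.ext (mul_left_cancel heq))
  · intro g
    let ρ : E →ₐ[F] Ω := (M.val.comp g.toAlgHom).comp (IntermediateField.inclusion hEM)
    have hρ : ∀ y : E, lift ρ ⟨y, hEM y.2⟩ = g ⟨y, hEM y.2⟩ := fun y =>
      Subtype.ext (hlift ρ y).symm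
    refine ⟨(ρ, ⟨(lift ρ)⁻¹ * g, ?_⟩), mul_inv_cancel_left _ _⟩
    rw [IntermediateField.mem_fixingSubgroup_iff]
    intro y hy
    have := hρ ⟨y, (IntermediateField.mem_restrict hEM y).1 hy⟩
    rw [AlgEquiv.mul_apply, ← this, ← AlgEquiv.mul_apply, inv_mul_cancel]
    rfl

end Embeddings

end AddVal

/-- Let `E/F` be finite separable inside `F^sep` and `M/F` a finite
Galois extension inside `F^sep` containing a normal closure of `E`.  For `r ≥ 0`, with
`s = ψ_{E/F}(r)` and `sM = ψ_{M/F}(r)`, two embeddings `σ, τ : E → F^sep` are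
`Ξ^r`-equivalent (i.e. `Ξ_{ψ_{E/F}(r)}`-equivalent) if and only if `τ = γ ∘ σ` for some
`γ` in the upper ramification subgroup `Gal(M/F)^r = Gal(M/F)_{ψ_{M/F}(r)}`. -/
theorem xiUpper_eq_upper_ramification_orbit
    {F Ω : Type*} [Field F] [Field Ω] [Algebra F Ω] [IsSepClosure F Ω]
    (V : AddVal Ω) (hnorm : V.IsNormalizedOn F) (hhens : V.IsHenselianOn F)
    (hperf : V.HasPerfectResidueFieldOn F)
    (E : IntermediateField F Ω) (hEfin : FiniteDimensional F ↥E)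
    (e : ℕ) (he : V.IsRamIdx E e)
    (M : IntermediateField F Ω) (hMfin : FiniteDimensional F ↥M)
    (hGal : IsGalois F ↥M) (eM : ℕ) (heM : V.IsRamIdx M eM)
    (hNC : ∀ (ρ : ↥E →ₐ[F] Ω) (x : ↥E), ρ x ∈ M)
    (r s sM : ℝ) (hr : 0 ≤ r) (hs : 0 ≤ s) (hsM : 0 ≤ sM)
    (hψE : herbrand V E e s = r)   -- `s = ψ_{E/F}(r)`
    (hψM : herbrand V M eM sM = r) -- `sM = ψ_{M/F}(r)`
    (σ τ : ↥E →ₐ[F] Ω) :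
    xiRel V E e s σ τ ↔
      ∃ γ : ↥M ≃ₐ[F] ↥M,
        xiRel V M eM sM (M.val.comp γ.toAlgHom) M.val ∧
        ∀ x : ↥E, τ x = ((γ ⟨σ x, hNC σ x⟩ : ↥M) : Ω) := by
  have hEM : E ≤ M := fun y hy => hNC E.val ⟨y, hy⟩
  let W : AddVal M := V.comap (algebraMap M Ω)
  have hinv : ∀ (γ : M ≃ₐ[F] M) x, W.v (γ x) = W.v x :=
    W.v_algEquiv (F := F) hnorm hhens
  have hF : (W.comap (algebraMap F M)).HasIndex 1 := by
    refine ⟨one_pos, fun y hy => ?_, ?_⟩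
    · obtain ⟨k, hk⟩ := hnorm.1 y hy
      exact ⟨k, by rw [Nat.cast_one, div_one]; exact hk⟩
    · obtain ⟨y, hy⟩ := hnorm.2
      exact ⟨y, by rw [Nat.cast_one, div_one]; exact hy⟩
  have hM : W.HasIndex eM := heM
  set E' := IntermediateField.restrict hEM with hE'
  have hE : (W.comap (algebraMap E' M)).HasIndex e := by
    refine ⟨he.1, fun y hy => ?_, ?_⟩
    · exact he.2.1 ⟨y, (IntermediateField.mem_restrict hEM _).1 y.2⟩
        fun h => hy (Subtype.ext (Subtype.ext (congrArg (fun z : E => (z : Ω)) h)))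
    · obtain ⟨y, hy⟩ := he.2.2
      exact ⟨⟨⟨y, hEM y.2⟩, (IntermediateField.mem_restrict hEM _).2 y.2⟩, hy⟩
  obtain ⟨x, hx⟩ := AddVal.exists_isGenerator (V := W) (F := F) hinv hF hM hperf
  choose lift hlift using fun ρ => AddVal.exists_algEquiv_lift hEM ρ (hNC ρ)
  have heE : (0 : ℝ) < e := by exact_mod_cast he.1
  have heM' : (0 : ℝ) < eM := by exact_mod_cast heM.1
  have hφE := herbrand_eq_sum_ramp (V := V) (Equiv.refl (E →ₐ[F] Ω))
    (a := fun ρ => cosetSum E'.fixingSubgroup (W.displacement x) (lift ρ))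
    (fun t ρ => by
      have h := AddVal.xiRel_iff_le_cosetSum hEM hinv hx e t (hlift ρ)
        (τ := E.val) (k := 1) (fun _ => rfl)
      rwa [inv_one, one_mul] at h) he.1 hs
  have hφM := herbrand_eq_sum_ramp (V := V) (Normal.algHomEquivAut F Ω M)
    (a := W.displacement x) (fun t ρ => by
      obtain ⟨g, rfl⟩ := (Normal.algHomEquivAut F Ω M).symm.surjective ρ
      rw [Equiv.apply_symm_apply]
      exact AddVal.xiRel_val_iff_le_displacement hinv hx eM t g) heM.1 hsM
  have hmain := le_cosetSum_iff_of_herbrand_eq E'.fixingSubgroup (W.displacement x)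
    AddVal.displacement_one (AddVal.min_displacement_le hinv) (AddVal.displacement_inv hinv)
    heE heM' (fun γ h => hM.eq_zero_of_lt (AddVal.displacement_nonneg hinv hx.1 γ) h)
    (hx.inertia_sum_mul hinv hperf E' hE hM) lift
    (AddVal.bijective_lift_mul hEM lift hlift) hs hsM
    (by rw [← hφE, ← hφM, hψE, hψM]) ((lift τ)⁻¹ * lift σ)
  rw [AddVal.xiRel_iff_le_cosetSum hEM hinv hx e s (hlift σ) (hlift τ), hmain]
  have hσ : ∀ y : E, (⟨σ y, hNC σ y⟩ : M) = lift σ ⟨y, hEM y.2⟩ := fun y =>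
    Subtype.ext (hlift σ y)
  have hτ : ∀ y : E, (⟨τ y, hNC τ y⟩ : M) = lift τ ⟨y, hEM y.2⟩ := fun y =>
    Subtype.ext (hlift τ y)
  simp only [AddVal.xiRel_val_iff_le_displacement hinv hx]
  constructor
  · rintro ⟨h, hh⟩
    refine ⟨lift τ * (h : M ≃ₐ[F] M)⁻¹ * (lift σ)⁻¹, ?_, fun y => ?_⟩
    · rw [← AddVal.displacement_inv hinv]
      refine (hh.trans (hx.displacement_le_conj hinv (lift τ) _)).trans_eq
        (congrArg (W.displacement x) ?_)
      group
    · have hfix : (h : M ≃ₐ[F] M)⁻¹ ⟨y, hEM y.2⟩ = ⟨y, hEM y.2⟩ :=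
        (IntermediateField.mem_fixingSubgroup_iff _ _).1 (inv_mem h.2) _
          ((IntermediateField.mem_restrict hEM _).2 y.2)
      rw [hσ, ← AlgEquiv.mul_apply, inv_mul_cancel_right, AlgEquiv.mul_apply, hfix]
      exact hlift τ y
  · rintro ⟨γ, hγ, hγτ⟩
    refine ⟨⟨(lift σ)⁻¹ * γ⁻¹ * lift τ, ?_⟩, ?_⟩
    · rw [IntermediateField.mem_fixingSubgroup_iff]
      intro y hy
      have hy' := (IntermediateField.mem_restrict hEM y).1 hy
      have h1 : lift τ y = (γ * lift σ) y := by
        rw [AlgEquiv.mul_apply]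
        have h2 := hτ ⟨y, hy'⟩
        have h3 := hσ ⟨y, hy'⟩
        exact h2.symm.trans ((Subtype.ext (hγτ ⟨y, hy'⟩)).trans (congrArg γ h3))
      rw [AlgEquiv.mul_apply, h1, ← AlgEquiv.mul_apply]
      have h4 : (lift σ)⁻¹ * γ⁻¹ * (γ * lift σ) = 1 := by group
      rw [h4, AlgEquiv.one_apply]
    · rw [← AddVal.displacement_inv hinv] at hγ
      refine (hγ.trans (hx.displacement_le_conj hinv (lift τ)⁻¹ _)).trans_eq
        (congrArg (W.displacement x) ?_)
      group
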